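/- Let 2 ≤ p < N. There exists a constant K_{N,p} > 0 such that for every open connected set Ω ⊊ ℝ^N and every u ∈ C_0^∞(Ω) one has ∫_Ω ( |∇u|^p − ((p−1)/p)^p |u|^p / D_{Ω,p}(x)^p ) dx ≥ K_{N,p} ( ∫_Ω |u|^{Np/(N−p)} dx )^{(N−p)/N}. -/

import Mathlib

open MeasureTheory Metric Set

noncomputable def dirDist {N : ℕ} (Ω : Set (EuclideanSpace ℝ (Fin N)))
    (x e : EuclideanSpace ℝ (Fin N)) : ℝ :=
  sInf {r : ℝ | ∃ t : ℝ, r = |t| ∧ x + t • e ∈ Ωᶜ}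

noncomputable def daviesWeight {N : ℕ} (Ω : Set (EuclideanSpace ℝ (Fin N)))
    (x : EuclideanSpace ℝ (Fin N)) : ℝ :=
  ((N : ℝ) * ⨍ e : sphere (0 : EuclideanSpace ℝ (Fin N)) 1,
      (dirDist Ω x (e : EuclideanSpace ℝ (Fin N)) ^ 2)⁻¹ ∂volume.toSphere) ^ (-(1:ℝ)/2)

noncomputable def daviesWeightP {N : ℕ} (p : ℝ) (Ω : Set (EuclideanSpace ℝ (Fin N)))
    (x : EuclideanSpace ℝ (Fin N)) : ℝ :=
  (Real.sqrt Real.pi * Real.Gamma ((N + p)/2) / (Real.Gamma ((p+1)/2) * Real.Gamma (N/2)) *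
    ⨍ e : sphere (0 : EuclideanSpace ℝ (Fin N)) 1,
      dirDist Ω x (e : EuclideanSpace ℝ (Fin N)) ^ (-p) ∂volume.toSphere) ^ (-1/p)

lemma abs_rpow_sub_two_mul_self_abs {p : ℝ} (hp : 1 < p) (a : ℝ) :
    |(|a| ^ (p - 2) * a)| = |a| ^ (p - 1) := by
  rcases eq_or_ne a 0 with rfl | ha
  · simp [Real.zero_rpow (by linarith : p - 1 ≠ 0)]
  · have h : 0 < |a| := abs_pos.2 ha
    rw [abs_mul, abs_of_nonneg (Real.rpow_nonneg h.le _), ← Real.rpow_add_one h.ne']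
    congr 1; ring

lemma abs_rpow_sub_two_mul_self_mul_self {p : ℝ} (hp : 1 < p) (a : ℝ) :
    |a| ^ (p - 2) * a * a = |a| ^ p := by
  rcases eq_or_ne a 0 with rfl | ha
  · simp [Real.zero_rpow (by linarith : p ≠ 0)]
  · have h : 0 < |a| := abs_pos.2 ha
    rw [mul_assoc, ← abs_mul_abs_self a, ← mul_assoc, ← Real.rpow_add_one h.ne',
      ← Real.rpow_add_one h.ne']
    congr 1; ring

lemma abs_add_rpow_ge_tangent {p : ℝ} (hp : 1 < p) (a c : ℝ) :
    |a| ^ p + p * (|a| ^ (p - 2) * a) * c ≤ |a + c| ^ p := by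
  have hpq := Real.HolderConjugate.conjExponent hp
  have hY := Real.young_inequality_of_nonneg (abs_nonneg (a + c))
    (Real.rpow_nonneg (abs_nonneg a) (p - 1)) hpq
  rw [← Real.rpow_mul (abs_nonneg a), hpq.sub_one_mul_conj] at hY
  have h1 : |a| ^ (p - 2) * a * (a + c) ≤ |a + c| * |a| ^ (p - 1) := by
    calc _ ≤ |(|a| ^ (p - 2) * a * (a + c))| := le_abs_self _
      _ = _ := by rw [abs_mul, abs_rpow_sub_two_mul_self_abs hp, mul_comm]
  have h2 := abs_rpow_sub_two_mul_self_mul_self hp a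
  have hp0 : 0 < p := by linarith
  have h3 : p.conjExponent = p / (p - 1) := rfl
  rw [h3] at hY
  have h4 : p * (|a + c| ^ p / p + |a| ^ p / (p / (p - 1))) = |a + c| ^ p + (p - 1) * |a| ^ p := by
    field_simp
  have h5 := mul_le_mul_of_nonneg_left (h1.trans hY) hp0.le
  rw [h4] at h5
  nlinarith

/-- The strengthened convexity of `|·|^p` for `p ≥ 2`. -/
lemma abs_add_rpow_ge {p : ℝ} (hp : 2 ≤ p) (a b : ℝ) :
    |a| ^ p + p * (|a| ^ (p - 2) * a) * b + 2 ^ (1 - p) * |b| ^ p ≤ |a + b| ^ p := by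
  have hp0 : 0 < p := by linarith
  have key : |a + b / 2| ^ p + |b / 2| ^ p ≤ (|a| ^ p + |a + b| ^ p) / 2 := by
    have e (x : ℝ) : |x| ^ p = (x ^ 2) ^ (p / 2) := by
      rw [← sq_abs, ← Real.rpow_natCast, ← Real.rpow_mul (abs_nonneg x)]
      congr 1; push_cast; ring
    simp only [e]
    refine (Real.add_rpow_le_rpow_add (sq_nonneg _) (sq_nonneg _) (by linarith)).trans ?_
    have := (convexOn_rpow (by linarith : 1 ≤ p / 2)).2 (sq_nonneg a : a ^ 2 ∈ Ici (0 : ℝ))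
      (sq_nonneg (a + b) : (a + b) ^ 2 ∈ Ici (0 : ℝ)) (by norm_num : (0 : ℝ) ≤ 1 / 2)
      (by norm_num : (0 : ℝ) ≤ 1 / 2) (by norm_num)
    simp only [smul_eq_mul] at this
    calc _ = (1 / 2 * a ^ 2 + 1 / 2 * (a + b) ^ 2) ^ (p / 2) := by congr 1; ring
      _ ≤ _ := this
      _ = _ := by ring
  have ht := abs_add_rpow_ge_tangent (by linarith : 1 < p) a (b / 2)
  have h2 : 2 ^ (1 - p) * |b| ^ p = 2 * |b / 2| ^ p := by
    rw [abs_div, Real.div_rpow (abs_nonneg _) (abs_nonneg _), abs_two,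
      Real.rpow_sub two_pos, Real.rpow_one]
    ring
  linarith

lemma intervalIntegral_mul_le_rpow_mul_rpow {a b p q : ℝ} (hab : a ≤ b) (hpq : p.HolderConjugate q)
    {f g : ℝ → ℝ} (hf : ContinuousOn f (Icc a b)) (hg : ContinuousOn g (Icc a b))
    (hf0 : ∀ t, 0 ≤ f t) (hg0 : ∀ t, 0 ≤ g t) :
    ∫ t in a..b, f t * g t ≤ (∫ t in a..b, f t ^ p) ^ (1 / p) * (∫ t in a..b, g t ^ q) ^ (1 / q) := by
  simp only [intervalIntegral.integral_of_le hab, ← integral_Icc_eq_integral_Ioc]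
  have hm {f : ℝ → ℝ} (hf : ContinuousOn f (Icc a b)) (s : ENNReal) :
      MemLp f s (volume.restrict (Icc a b)) := by
    obtain ⟨C, hC⟩ := isCompact_Icc.exists_bound_of_continuousOn hf
    exact MemLp.of_bound (hf.aestronglyMeasurable measurableSet_Icc) C
      ((ae_restrict_iff' measurableSet_Icc).2 (.of_forall hC))
  exact integral_mul_le_Lp_mul_Lq_of_nonneg hpq (.of_forall hf0) (.of_forall hg0) (hm hf _) (hm hg _)

section HalfInterval

variable {δ L : ℝ} {h : ℝ → ℝ}

lemma continuousOn_deriv_sub_div (hh : ContDiff ℝ 1 h) (hδ : 0 < δ) (α : ℝ) :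
    ContinuousOn (fun t => deriv h t - α * h t / t) (Icc δ L) := by
  have h1 : Continuous (deriv h) := hh.continuous_deriv le_rfl
  have h2 : Continuous h := hh.continuous
  refine h1.continuousOn.sub (ContinuousOn.div (by fun_prop) continuousOn_id fun t ht => ?_)
  exact (hδ.trans_le ht.1).ne'

lemma continuous_abs_rpow_sub_two_mul {s : ℝ} (hs : 1 < s) (hh : Continuous h) :
    Continuous fun t => |h t| ^ (s - 2) * h t := by
  have : Continuous fun x : ℝ => |x| ^ (s - 2) * x := by
    have hc : (fun x : ℝ => |x| ^ (s - 2) * x) = deriv fun x : ℝ => |x| ^ s / s := by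
      ext x
      rw [((hasDerivAt_abs_rpow x hs).div_const s).deriv]
      field_simp
    refine continuous_iff_continuousAt.2 fun x => ?_
    rcases eq_or_ne x 0 with rfl | hx
    · have : Filter.Tendsto (fun x : ℝ => |x| ^ (s - 1)) (nhds 0) (nhds 0) := by
        have : Continuous fun x : ℝ => |x| ^ (s - 1) :=
          continuous_abs.rpow_const fun _ => Or.inr (by linarith)
        simpa [Real.zero_rpow (by linarith : s - 1 ≠ 0)] using this.tendsto 0
      have h2 : Filter.Tendsto (fun x : ℝ => |x| ^ (s - 2) * x) (nhds 0) (nhds 0) := by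
        rw [tendsto_zero_iff_abs_tendsto_zero]
        simpa [Function.comp_def, abs_rpow_sub_two_mul_self_abs hs] using this
      simpa [ContinuousAt] using h2
    · exact (continuous_abs.continuousAt.rpow_const (Or.inl (abs_ne_zero.2 hx))).mul continuousAt_id
  exact this.comp hh

lemma integral_mul_abs_rpow_eq (hh : ContDiff ℝ 1 h) (hδ : 0 < δ) (hL : δ ≤ L) (h0 : h δ = 0)
    (α : ℝ) {s : ℝ} (hs : 1 < s) :
    L * |h L| ^ s = (1 + α * s) * (∫ t in δ..L, |h t| ^ s) +
      s * ∫ t in δ..L, t * (|h t| ^ (s - 2) * h t * (deriv h t - α * h t / t)) := by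
  have hb := continuousOn_deriv_sub_div (L := L) hh hδ α
  have hc := continuous_abs_rpow_sub_two_mul hs hh.continuous
  have hs' : Continuous fun t => |h t| ^ s :=
    hh.continuous.abs.rpow_const fun _ => Or.inr (by linarith)
  have hi1 : IntervalIntegrable (fun t => |h t| ^ s) volume δ L := hs'.intervalIntegrable _ _
  have hi2 : IntervalIntegrable
      (fun t => t * (|h t| ^ (s - 2) * h t * (deriv h t - α * h t / t))) volume δ L := by
    apply ContinuousOn.intervalIntegrable
    rw [uIcc_of_le hL]
    exact continuousOn_id.mul (hc.continuousOn.mul hb)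
  rw [← intervalIntegral.integral_const_mul, ← intervalIntegral.integral_const_mul,
    ← intervalIntegral.integral_add (hi1.const_mul _) (hi2.const_mul _),
    intervalIntegral.integral_eq_sub_of_hasDerivAt (f := fun t => t * |h t| ^ s) _
      ((hi1.const_mul _).add (hi2.const_mul _))]
  · simp [h0, Real.zero_rpow (by linarith : s ≠ 0)]
  · intro t ht
    rw [uIcc_of_le hL] at ht
    have ht0 : t ≠ 0 := (hδ.trans_le ht.1).ne'
    have hd : HasDerivAt h (deriv h t) t :=
      (hh.differentiable one_ne_zero t).hasDerivAt
    have := (hasDerivAt_id t).mul ((hasDerivAt_abs_rpow (h t) hs).comp t hd)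
    refine this.congr_deriv ?_
    have e := abs_rpow_sub_two_mul_self_mul_self hs (h t)
    simp only [Function.comp, id]
    rw [← e]
    field_simp
    ring

/-- Integrating `(|h|^s t^{-β})'` over `[t, L]`. -/
lemma abs_rpow_mul_rpow_eq (hh : ContDiff ℝ 1 h) {t : ℝ} (ht : 0 < t) (hL : t ≤ L)
    (α : ℝ) {s : ℝ} (hs : 1 < s) :
    |h L| ^ s * L ^ (-(α * s)) - |h t| ^ s * t ^ (-(α * s)) =
      ∫ τ in t..L, s * (τ ^ (-(α * s)) * (|h τ| ^ (s - 2) * h τ * (deriv h τ - α * h τ / τ))) := by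
  have hb := continuousOn_deriv_sub_div (L := L) hh ht α
  have hc := continuous_abs_rpow_sub_two_mul hs hh.continuous
  have hpos : ∀ τ ∈ Icc t L, τ ≠ 0 := fun τ hτ => (ht.trans_le hτ.1).ne'
  have hi2 : IntervalIntegrable
      (fun τ => s * (τ ^ (-(α * s)) * (|h τ| ^ (s - 2) * h τ * (deriv h τ - α * h τ / τ))))
      volume t L := by
    apply ContinuousOn.intervalIntegrable
    rw [uIcc_of_le hL]
    exact continuousOn_const.mul ((continuousOn_id.rpow_const fun τ hτ => Or.inl (hpos τ hτ)).mul
      (hc.continuousOn.mul hb))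
  rw [intervalIntegral.integral_eq_sub_of_hasDerivAt (f := fun τ => |h τ| ^ s * τ ^ (-(α * s))) _
      hi2]
  intro τ hτ
  rw [uIcc_of_le hL] at hτ
  have hτ0 := hpos τ hτ
  have hd : HasDerivAt h (deriv h τ) τ :=
    (hh.differentiable one_ne_zero τ).hasDerivAt
  have := ((hasDerivAt_abs_rpow (h τ) hs).comp τ hd).mul
    (Real.hasDerivAt_rpow_const (p := -(α * s)) (Or.inl hτ0))
  refine this.congr_deriv ?_
  have e := abs_rpow_sub_two_mul_self_mul_self hs (h τ)
  simp only [Function.comp]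
  rw [← e, Real.rpow_sub_one hτ0]
  field_simp
  ring

end HalfInterval

section HalfInterval

variable {δ L : ℝ} {h : ℝ → ℝ}

lemma energy_ge_of_half_interval (hh : ContDiff ℝ 1 h) (hδ : 0 < δ) (hL : δ ≤ L) (h0 : h δ = 0)
    {p α : ℝ} (hp : 2 ≤ p) (hα : α * p = p - 1) :
    2 ^ (1 - p) * (∫ t in δ..L, |deriv h t - α * h t / t| ^ p) +
        α ^ (p - 1) * (|h L| ^ p * L ^ (-(p - 1))) ≤
      ∫ t in δ..L, (|deriv h t| ^ p - α ^ p * (|h t| ^ p * t ^ (-p))) := by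
  have hp0 : 0 < p := by linarith
  have hα0 : 0 < α := by
    have : 0 < α * p := by rw [hα]; linarith
    exact (pos_iff_pos_of_mul_pos this).2 hp0
  have hp1 : 1 < p := by linarith
  have hb := continuousOn_deriv_sub_div (L := L) hh hδ α
  have hc := continuous_abs_rpow_sub_two_mul hp1 hh.continuous
  have hpos : ∀ τ ∈ Icc δ L, 0 < τ := fun τ hτ => hδ.trans_le hτ.1
  have hd : Continuous (deriv h) := hh.continuous_deriv le_rfl
  have hcont := hh.continuous
  have hi1 : IntervalIntegrable (fun t => |deriv h t - α * h t / t| ^ p) volume δ L := by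
    apply ContinuousOn.intervalIntegrable
    rw [uIcc_of_le hL]
    exact hb.abs.rpow_const fun _ _ => Or.inr hp0.le
  have hi2 : IntervalIntegrable
      (fun τ => p * (τ ^ (-(α * p)) * (|h τ| ^ (p - 2) * h τ * (deriv h τ - α * h τ / τ))))
      volume δ L := by
    apply ContinuousOn.intervalIntegrable
    rw [uIcc_of_le hL]
    exact continuousOn_const.mul ((continuousOn_id.rpow_const
      fun τ hτ => Or.inl (hpos τ hτ).ne').mul (hc.continuousOn.mul hb))
  have hi3 : IntervalIntegrable (fun t => |deriv h t| ^ p - α ^ p * (|h t| ^ p * t ^ (-p)))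
      volume δ L := by
    apply ContinuousOn.intervalIntegrable
    rw [uIcc_of_le hL]
    refine (hd.abs.rpow_const fun _ => Or.inr hp0.le).continuousOn.sub
      (continuousOn_const.mul (ContinuousOn.mul ?_ ?_))
    · exact (hcont.abs.rpow_const fun _ => Or.inr hp0.le).continuousOn
    · exact continuousOn_id.rpow_const fun τ hτ => Or.inl (hpos τ hτ).ne'
  have hB := abs_rpow_mul_rpow_eq hh hδ hL α hp1
  rw [h0, abs_zero, Real.zero_rpow hp0.ne', zero_mul, sub_zero] at hB
  rw [← hα, hB, ← intervalIntegral.integral_const_mul, ← intervalIntegral.integral_const_mul,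
    ← intervalIntegral.integral_add (hi1.const_mul _) (hi2.const_mul _)]
  refine intervalIntegral.integral_mono_on hL ((hi1.const_mul _).add (hi2.const_mul _)) hi3
    fun t ht => ?_
  have ht0 := hpos t ht
  have key := abs_add_rpow_ge hp (α * h t / t) (deriv h t - α * h t / t)
  rw [add_sub_cancel, abs_div, abs_mul, abs_of_pos hα0, abs_of_pos ht0,
    Real.div_rpow (by positivity) ht0.le, Real.mul_rpow hα0.le (abs_nonneg _),
    Real.div_rpow (by positivity) ht0.le, Real.mul_rpow hα0.le (abs_nonneg _)] at key
  rw [hα]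
  have e1 : α ^ (α * p) = α ^ (p - 2) * α := by
    rw [hα, ← Real.rpow_add_one hα0.ne']; congr 1; ring
  have e2 : t ^ (-(p - 1)) = (t ^ (p - 2))⁻¹ * t⁻¹ := by
    rw [← Real.rpow_neg ht0.le, ← Real.rpow_neg_one t, ← Real.rpow_add ht0]; congr 1; ring
  rw [← hα, e1, hα, e2, Real.rpow_neg ht0.le]
  have e3 : α ^ p * |h t| ^ p / t ^ p = α ^ p * (|h t| ^ p * (t ^ p)⁻¹) := by
    rw [div_eq_mul_inv, mul_assoc]
  have e4 : p * (α ^ (p - 2) * |h t| ^ (p - 2) / t ^ (p - 2) * (α * h t / t)) *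
      (deriv h t - α * h t / t) = α ^ (p - 2) * α * (p * ((t ^ (p - 2))⁻¹ * t⁻¹ *
        (|h t| ^ (p - 2) * h t * (deriv h t - α * h t / t)))) := by
    simp only [div_eq_mul_inv]; ring
  rw [e3, e4] at key
  linarith

lemma abs_rpow_le_of_half_interval (hh : ContDiff ℝ 1 h) (hδ : 0 < δ) {α q : ℝ} (hα : 0 < α)
    (hq : 1 < q) {t : ℝ} (ht : t ∈ Icc δ L) :
    |h t| ^ q ≤ |h L| ^ q + q * ∫ τ in δ..L, |h τ| ^ (q - 1) * |deriv h τ - α * h τ / τ| := by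
  have ht0 : 0 < t := hδ.trans_le ht.1
  have hq0 : 0 < q := by linarith
  have hb := continuousOn_deriv_sub_div (L := L) hh hδ α
  have hc := continuous_abs_rpow_sub_two_mul hq hh.continuous
  have heq := abs_rpow_mul_rpow_eq hh ht0 ht.2 α hq
  have hX : ContinuousOn (fun τ => |h τ| ^ (q - 1) * |deriv h τ - α * h τ / τ|) (Icc δ L) :=
    (hh.continuous.abs.rpow_const fun _ => Or.inr (by linarith)).continuousOn.mul hb.abs
  have hXi : IntervalIntegrable (fun τ => |h τ| ^ (q - 1) * |deriv h τ - α * h τ / τ|)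
      volume δ L := by
    apply ContinuousOn.intervalIntegrable
    rwa [uIcc_of_le (ht.1.trans ht.2)]
  have hXi' : IntervalIntegrable (fun τ => |h τ| ^ (q - 1) * |deriv h τ - α * h τ / τ|)
      volume t L := hXi.mono_set (by
        rw [uIcc_of_le ht.2, uIcc_of_le (ht.1.trans ht.2)]; exact Icc_subset_Icc_left ht.1)
  have hle : ∫ τ in t..L, |h τ| ^ (q - 1) * |deriv h τ - α * h τ / τ| ≤
      ∫ τ in δ..L, |h τ| ^ (q - 1) * |deriv h τ - α * h τ / τ| := by
    refine intervalIntegral.integral_mono_interval ht.1 ht.2 le_rfl (.of_forall fun τ => ?_) hXi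
    change 0 ≤ |h τ| ^ (q - 1) * |deriv h τ - α * h τ / τ|
    positivity
  have hbound : |∫ τ in t..L, q * (τ ^ (-(α * q)) *
      (|h τ| ^ (q - 2) * h τ * (deriv h τ - α * h τ / τ)))| ≤
      q * t ^ (-(α * q)) * ∫ τ in t..L, |h τ| ^ (q - 1) * |deriv h τ - α * h τ / τ| := by
    rw [← intervalIntegral.integral_const_mul, ← Real.norm_eq_abs]
    refine intervalIntegral.norm_integral_le_of_norm_le ht.2 (.of_forall fun τ hτ => ?_)
      (hXi'.const_mul _)
    have hτ0 : 0 < τ := ht0.trans hτ.1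
    rw [Real.norm_eq_abs, abs_mul, abs_mul, abs_mul, abs_rpow_sub_two_mul_self_abs hq,
      abs_of_pos hq0, abs_of_pos (Real.rpow_pos_of_pos hτ0 _), mul_assoc]
    exact mul_le_mul_of_nonneg_left (mul_le_mul_of_nonneg_right
      (Real.rpow_le_rpow_of_nonpos ht0 hτ.1.le (neg_nonpos.2 (mul_pos hα hq0).le))
      (by positivity)) hq0.le
  have hLt : L ^ (-(α * q)) ≤ t ^ (-(α * q)) :=
    Real.rpow_le_rpow_of_nonpos ht0 ht.2 (neg_nonpos.2 (mul_pos hα hq0).le)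
  have htp : 0 < t ^ (-(α * q)) := Real.rpow_pos_of_pos ht0 _
  have h1 := neg_le_of_abs_le hbound
  rw [← heq] at h1
  have h2 : |h L| ^ q * L ^ (-(α * q)) ≤ |h L| ^ q * t ^ (-(α * q)) := by gcongr
  refine le_of_mul_le_mul_right (a := t ^ (-(α * q))) ?_ htp
  have h3 := mul_le_mul_of_nonneg_left hle (mul_pos hq0 htp).le
  linarith

lemma abs_rpow_sup_le_of_half_interval (hh : ContDiff ℝ 1 h) (hδ : 0 < δ) (hL : δ ≤ L)
    (h0 : h δ = 0) {p q α : ℝ} (hp : 2 ≤ p) (hq : 1 < q) (hα : α * p = p - 1)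
    {t : ℝ} (ht : t ∈ Icc δ L) :
    |h t| ^ q ≤ (1 + 3 * q) * ((∫ τ in δ..L, |deriv h τ - α * h τ / τ| ^ p) +
        |h L| ^ p * L ^ (-(p - 1))) ^ (1 / p) * (∫ τ in δ..L, |h τ| ^ ((q - 1) / α)) ^ α := by
  have hp0 : 0 < p := by linarith
  have hp1 : 1 < p := by linarith
  have hα0 : 0 < α := by
    have : 0 < α * p := by rw [hα]; linarith
    exact (pos_iff_pos_of_mul_pos this).2 hp0
  have hα1 : α < 1 := by nlinarith
  have hL0 : 0 < L := hδ.trans_le hL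
  have hq0 : 0 < q := by linarith
  have hpq : (1 / α).HolderConjugate p := by
    rw [Real.holderConjugate_iff]
    refine ⟨by rw [lt_div_iff₀ hα0]; linarith, ?_⟩
    field_simp
    linarith
  have hcont := hh.continuous
  have hb := continuousOn_deriv_sub_div (L := L) hh hδ α
  have hpos : ∀ τ ∈ Icc δ L, 0 < τ := fun τ hτ => hδ.trans_le hτ.1
  set A := ∫ τ in δ..L, |deriv h τ - α * h τ / τ| ^ p with hA
  set B := |h L| ^ p * L ^ (-(p - 1)) with hB
  set J := ∫ τ in δ..L, |h τ| ^ ((q - 1) / α) with hJ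
  set X := ∫ τ in δ..L, |h τ| ^ (q - 1) * |deriv h τ - α * h τ / τ| with hX
  have hA0 : 0 ≤ A := intervalIntegral.integral_nonneg hL fun _ _ => by positivity
  have hB0 : 0 ≤ B := by positivity
  have hJ0 : 0 ≤ J := intervalIntegral.integral_nonneg hL fun _ _ => by positivity
  have hpow (s : ℝ) (hs : 0 ≤ s) : Continuous fun τ => |h τ| ^ s :=
    hcont.abs.rpow_const fun _ => Or.inr hs
  have hJe : ∫ τ in δ..L, (|h τ| ^ (q - 1)) ^ (1 / α) = J := by
    refine intervalIntegral.integral_congr fun τ _ => ?_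
    rw [← Real.rpow_mul (abs_nonneg _)]; congr 1; ring
  -- Hölder
  have hXle : X ≤ J ^ α * A ^ (1 / p) := by
    have := intervalIntegral_mul_le_rpow_mul_rpow hL hpq
      (hpow (q - 1) (by linarith)).continuousOn hb.abs
      (fun _ => by positivity) (fun _ => by positivity)
    rwa [hJe, one_div_one_div] at this
  have hqle : ∫ τ in δ..L, |h τ| ^ q ≤ J ^ α * (∫ τ in δ..L, |h τ| ^ p) ^ (1 / p) := by
    have := intervalIntegral_mul_le_rpow_mul_rpow hL hpq
      (hpow (q - 1) (by linarith)).continuousOn hcont.abs.continuousOn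
      (fun _ => by positivity) (fun _ => by positivity)
    rw [hJe, one_div_one_div] at this
    convert this using 1
    refine intervalIntegral.integral_congr fun τ _ => ?_
    change |h τ| ^ q = |h τ| ^ (q - 1) * |h τ|
    rcases eq_or_ne (h τ) 0 with h' | h'
    · simp [h', Real.zero_rpow hq0.ne']
    · rw [← Real.rpow_add_one (abs_ne_zero.2 h')]; congr 1; ring
  have hcross {s : ℝ} (hs : 1 < s) :
      |∫ τ in δ..L, τ * (|h τ| ^ (s - 2) * h τ * (deriv h τ - α * h τ / τ))| ≤
        ∫ τ in δ..L, L * (|h τ| ^ (s - 1) * |deriv h τ - α * h τ / τ|) := by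
    rw [← Real.norm_eq_abs]
    refine intervalIntegral.norm_integral_le_of_norm_le hL (.of_forall fun τ hτ => ?_) ?_
    · have hτ0 : 0 < τ := hδ.trans hτ.1
      rw [Real.norm_eq_abs, abs_mul, abs_mul, abs_rpow_sub_two_mul_self_abs hs, abs_of_pos hτ0]
      gcongr
      exact hτ.2
    · apply ContinuousOn.intervalIntegrable
      rw [uIcc_of_le hL]
      exact continuousOn_const.mul ((hpow _ (by linarith)).continuousOn.mul hb.abs)
  -- the `L^p` bound
  have hPle : ∫ τ in δ..L, |h τ| ^ p ≤ L ^ p * (A + B) := by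
    have h1 := integral_mul_abs_rpow_eq hh hδ hL h0 α hp1
    have h2 : ∫ τ in δ..L, L * (|h τ| ^ (p - 1) * |deriv h τ - α * h τ / τ|) ≤
        α * (∫ τ in δ..L, |h τ| ^ p) + (1 / p) * L ^ p * A := by
      rw [hA, ← intervalIntegral.integral_const_mul, ← intervalIntegral.integral_const_mul,
        ← intervalIntegral.integral_add]
      · refine intervalIntegral.integral_mono_on hL ?_ ?_ fun τ hτ => ?_
        · apply ContinuousOn.intervalIntegrable
          rw [uIcc_of_le hL]
          exact continuousOn_const.mul ((hpow _ (by linarith)).continuousOn.mul hb.abs)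
        · apply ContinuousOn.intervalIntegrable
          rw [uIcc_of_le hL]
          exact (continuousOn_const.mul (hpow _ hp0.le).continuousOn).add
            (continuousOn_const.mul (hb.abs.rpow_const fun _ _ => Or.inr hp0.le))
        · have hY := Real.young_inequality_of_nonneg (a := |h τ| ^ (p - 1))
            (b := L * |deriv h τ - α * h τ / τ|) (by positivity) (by positivity) hpq
          rw [← Real.rpow_mul (abs_nonneg _), Real.mul_rpow hL0.le (abs_nonneg _)] at hY
          have e : (p - 1) * (1 / α) = p := by
            rw [← hα]; field_simp
          rw [e] at hY
          calc _ = |h τ| ^ (p - 1) * (L * |deriv h τ - α * h τ / τ|) := by ring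
            _ ≤ _ := hY
            _ = _ := by field_simp
      · exact ((hpow _ hp0.le).intervalIntegrable _ _).const_mul _
      · apply IntervalIntegrable.const_mul
        apply ContinuousOn.intervalIntegrable
        rw [uIcc_of_le hL]
        exact hb.abs.rpow_const fun _ _ => Or.inr hp0.le
    have h3 := (neg_le_of_abs_le (hcross hp1))
    have e1 : L * |h L| ^ p = L ^ p * B := by
      rw [hB, mul_left_comm, ← Real.rpow_add hL0]
      simp [mul_comm]
    rw [e1] at h1
    have h4 : p * (∫ τ in δ..L, L * (|h τ| ^ (p - 1) * |deriv h τ - α * h τ / τ|)) ≤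
        (p - 1) * (∫ τ in δ..L, |h τ| ^ p) + L ^ p * A := by
      refine (mul_le_mul_of_nonneg_left h2 hp0.le).trans (le_of_eq ?_)
      rw [← hα]; field_simp
    rw [hα] at h1
    nlinarith [mul_le_mul_of_nonneg_left h3 hp0.le]
  set M := J ^ α * (A + B) ^ (1 / p) with hM
  have hM0 : 0 ≤ M := by positivity
  have hXM : X ≤ M := hXle.trans (by rw [hM]; gcongr; linarith)
  have hqM : ∫ τ in δ..L, |h τ| ^ q ≤ L * M := by
    refine hqle.trans ?_
    have : (∫ τ in δ..L, |h τ| ^ p) ^ (1 / p) ≤ L * (A + B) ^ (1 / p) := by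
      calc _ ≤ (L ^ p * (A + B)) ^ (1 / p) := by
            gcongr
            exact intervalIntegral.integral_nonneg hL fun _ _ => by positivity
        _ = _ := by
            rw [Real.mul_rpow (by positivity) (by positivity), ← Real.rpow_mul hL0.le,
              mul_one_div_cancel hp0.ne', Real.rpow_one]
    calc _ ≤ J ^ α * (L * (A + B) ^ (1 / p)) := by gcongr
      _ = _ := by rw [hM]; ring
  have hLM : |h L| ^ q ≤ (1 + 2 * q) * M := by
    have h1 := integral_mul_abs_rpow_eq hh hδ hL h0 α hq
    have h2 := le_of_abs_le (hcross hq)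
    rw [intervalIntegral.integral_const_mul] at h2
    have h3 : L * |h L| ^ q ≤ L * ((1 + 2 * q) * M) := by
      rw [h1]
      calc _ ≤ (1 + α * q) * (L * M) + q * (L * M) :=
            add_le_add (mul_le_mul_of_nonneg_left hqM (by positivity))
              (mul_le_mul_of_nonneg_left (h2.trans (by gcongr)) hq0.le)
        _ ≤ (1 + 1 * q) * (L * M) + q * (L * M) := by gcongr
        _ = _ := by ring
    exact le_of_mul_le_mul_left h3 hL0
  calc _ ≤ |h L| ^ q + q * X := abs_rpow_le_of_half_interval hh hδ hα0 hq ht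
    _ ≤ (1 + 2 * q) * M + q * M := by gcongr
    _ = _ := by rw [hM]; ring

end HalfInterval

/-- The one-dimensional Hardy deficit density `|f'|^p - α^p |f|^p w`. -/
noncomputable def hardyDensity (p α : ℝ) (f w : ℝ → ℝ) (t : ℝ) : ℝ :=
  |deriv f t| ^ p - α ^ p * (|f t| ^ p * w t)

/-- The constant in the one-dimensional Hardy–Sobolev estimate. -/
noncomputable def hardyConst (p q α : ℝ) : ℝ :=
  (1 + 3 * q) * (2 ^ (p - 1) + α ^ (-(p - 1))) ^ (1 / p)

lemma hardyDensity_eq_zero {p α : ℝ} (hp : 0 < p) {f : ℝ → ℝ} (w : ℝ → ℝ) {t δ : ℝ} {a : ℝ}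
    (hf : ∀ s, |s - a| < δ → f s = 0) (ht : |t - a| < δ) : hardyDensity p α f w t = 0 := by
  have : f =ᶠ[nhds t] fun _ => (0 : ℝ) := by
    have ho : IsOpen {s : ℝ | |s - a| < δ} := isOpen_lt (by fun_prop) continuous_const
    exact Filter.eventually_of_mem (ho.mem_nhds ht) hf
  simp [hardyDensity, this.deriv_eq, this.eq_of_nhds, Real.zero_rpow hp.ne']

lemma half_interval_hardy {p q α δ L : ℝ} (hp : 2 ≤ p) (hq : 1 < q) (hα : α * p = p - 1)
    {h w : ℝ → ℝ} (hh : ContDiff ℝ 1 h) (hδ : 0 < δ) (hL : 0 < L) (h0 : ∀ t, |t - 0| < δ → h t = 0)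
    (hw : ∀ t, 0 < t → t ≤ L → w t ≤ t ^ (-p))
    (hi : IntervalIntegrable (hardyDensity p α h w) volume 0 L) :
    0 ≤ (∫ t in 0..L, hardyDensity p α h w t) ∧ ∀ t ∈ Icc 0 L,
      |h t| ^ q ≤ hardyConst p q α * (∫ t in 0..L, hardyDensity p α h w t) ^ (1 / p) *
        (∫ t in 0..L, |h t| ^ ((q - 1) / α)) ^ α := by
  have hp0 : 0 < p := by linarith
  have hq0 : 0 < q := by linarith
  have hα0 : 0 < α := by
    have : 0 < α * p := by rw [hα]; linarith
    exact (pos_iff_pos_of_mul_pos this).2 hp0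
  set ε := min (δ / 2) (L / 2) with hε
  have hε0 : 0 < ε := by positivity
  have hεδ : ε < δ := (min_le_left _ _).trans_lt (by linarith)
  have hεL : ε ≤ L := (min_le_right _ _).trans (by linarith)
  have hsmall : ∀ t ∈ Icc 0 ε, |t - 0| < δ := fun t ht => by
    rw [sub_zero, abs_of_nonneg ht.1]; exact ht.2.trans_lt hεδ
  have hhε : h ε = 0 := h0 _ (hsmall ε ⟨hε0.le, le_rfl⟩)
  have hi1 : IntervalIntegrable (hardyDensity p α h w) volume ε L := hi.mono_set (by
    rw [uIcc_of_le hεL, uIcc_of_le hL.le]; exact Icc_subset_Icc_left hε0.le)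
  have hi2 : IntervalIntegrable (hardyDensity p α h w) volume 0 ε := hi.mono_set (by
    rw [uIcc_of_le hε0.le, uIcc_of_le hL.le]; exact Icc_subset_Icc_right hεL)
  have hsplit : ∫ t in 0..L, hardyDensity p α h w t = ∫ t in ε..L, hardyDensity p α h w t := by
    rw [← intervalIntegral.integral_add_adjacent_intervals hi2 hi1, add_eq_right]
    rw [intervalIntegral.integral_congr (g := fun _ => (0 : ℝ)), intervalIntegral.integral_zero]
    intro t ht
    rw [uIcc_of_le hε0.le] at ht
    exact hardyDensity_eq_zero hp0 w h0 (hsmall t ht)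
  have hJ : ∫ t in ε..L, |h t| ^ ((q - 1) / α) ≤ ∫ t in 0..L, |h t| ^ ((q - 1) / α) := by
    refine intervalIntegral.integral_mono_interval hε0.le hεL le_rfl
      (.of_forall fun τ => ?_) ?_
    · change 0 ≤ |h τ| ^ ((q - 1) / α)
      positivity
    · exact (hh.continuous.abs.rpow_const fun _ => Or.inr
        (div_nonneg (by linarith) hα0.le)).intervalIntegrable _ _
  have hJ0 : 0 ≤ ∫ t in ε..L, |h t| ^ ((q - 1) / α) :=
    intervalIntegral.integral_nonneg hεL fun _ _ => by positivity
  have hE := energy_ge_of_half_interval hh hε0 hεL hhε hp hα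
  have hsup := fun t => abs_rpow_sup_le_of_half_interval hh hε0 hεL hhε hp hq hα (t := t)
  have hA0 : 0 ≤ ∫ τ in ε..L, |deriv h τ - α * h τ / τ| ^ p :=
    intervalIntegral.integral_nonneg hεL fun _ _ => by positivity
  have hB0 : 0 ≤ |h L| ^ p * L ^ (-(p - 1)) := by positivity
  set A := ∫ τ in ε..L, |deriv h τ - α * h τ / τ| ^ p
  set B := |h L| ^ p * L ^ (-(p - 1))
  have hE2 : ∫ t in ε..L, (|deriv h t| ^ p - α ^ p * (|h t| ^ p * t ^ (-p))) ≤
      ∫ t in ε..L, hardyDensity p α h w t := by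
    refine intervalIntegral.integral_mono_on hεL ?_ hi1 fun t ht => ?_
    · apply ContinuousOn.intervalIntegrable
      rw [uIcc_of_le hεL]
      refine ((hh.continuous_deriv le_rfl).abs.rpow_const fun _ => Or.inr hp0.le).continuousOn.sub
        (continuousOn_const.mul (ContinuousOn.mul ?_ ?_))
      · exact (hh.continuous.abs.rpow_const fun _ => Or.inr hp0.le).continuousOn
      · exact continuousOn_id.rpow_const fun τ hτ => Or.inl (hε0.trans_le hτ.1).ne'
    · have := hw t (hε0.trans_le ht.1) ht.2
      unfold hardyDensity
      gcongr
  have hE3 := hE.trans hE2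
  set E := ∫ t in ε..L, hardyDensity p α h w t
  have c1 : (0 : ℝ) < 2 ^ (p - 1) := by positivity
  have c2 : 0 < α ^ (-(p - 1)) := by positivity
  have hE0 : 0 ≤ E := le_trans (by positivity) hE3
  have hAB : A + B ≤ (2 ^ (p - 1) + α ^ (-(p - 1))) * E := by
    have h1 : A = 2 ^ (p - 1) * (2 ^ (1 - p) * A) := by
      rw [← mul_assoc, ← Real.rpow_add two_pos]; simp
    have h2 : B = α ^ (-(p - 1)) * (α ^ (p - 1) * B) := by
      rw [← mul_assoc, ← Real.rpow_add hα0]; simp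
    have h3 : 2 ^ (1 - p) * A ≤ E := le_trans (le_add_of_nonneg_right (by positivity)) hE3
    have h4 : α ^ (p - 1) * B ≤ E := le_trans (le_add_of_nonneg_left (by positivity)) hE3
    rw [h1, h2, add_mul]
    gcongr
  rw [hsplit]
  refine ⟨hE0, fun t ht => ?_⟩
  have hC0 : 0 ≤ hardyConst p q α := by unfold hardyConst; positivity
  rcases le_total t ε with h' | h'
  · rw [h0 t (hsmall t ⟨ht.1, h'⟩), abs_zero, Real.zero_rpow hq0.ne']
    have := hJ0.trans hJ
    positivity
  · refine (hsup t ⟨h', ht.2⟩).trans ?_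
    have hK := (Real.rpow_le_rpow (by positivity) hAB (by positivity : 0 ≤ 1 / p)).trans_eq
      (Real.mul_rpow (by positivity) hE0)
    unfold hardyConst
    rw [mul_assoc (1 + 3 * q) _ (E ^ (1 / p))]
    gcongr

lemma interval_hardy {p q α δ a b : ℝ} (hp : 2 ≤ p) (hq : 1 < q) (hα : α * p = p - 1)
    {f w : ℝ → ℝ} (hf : ContDiff ℝ 1 f) (hδ : 0 < δ) (hab : a < b)
    (ha : ∀ t, |t - a| < δ → f t = 0) (hb : ∀ t, |t - b| < δ → f t = 0)
    (hw : ∀ t ∈ Ioo a b, w t ≤ (min (t - a) (b - t)) ^ (-p))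
    (hi : Integrable (hardyDensity p α f w)) :
    0 ≤ (∫ t in a..b, hardyDensity p α f w t) ∧ ∀ t ∈ Icc a b,
      |f t| ^ q ≤ hardyConst p q α * (∫ t in a..b, hardyDensity p α f w t) ^ (1 / p) *
        (∫ t in a..b, |f t| ^ ((q - 1) / α)) ^ α := by
  have hp0 : 0 < p := by linarith
  have hq0 : 0 < q := by linarith
  have hα0 : 0 < α := by
    have : 0 < α * p := by rw [hα]; linarith
    exact (pos_iff_pos_of_mul_pos this).2 hp0
  have hC0 : 0 ≤ hardyConst p q α := by unfold hardyConst; positivity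
  set L := (b - a) / 2 with hL
  have hL0 : 0 < L := by simp only [hL]; linarith
  have hs0 : 0 ≤ (q - 1) / α := div_nonneg (by linarith) hα0.le
  have hJi (x y : ℝ) : IntervalIntegrable (fun t => |f t| ^ ((q - 1) / α)) volume x y :=
    (hf.continuous.abs.rpow_const fun _ => Or.inr hs0).intervalIntegrable _ _
  have e1 : hardyDensity p α (fun t => f (a + t)) (fun t => w (a + t)) =
      fun t => hardyDensity p α f w (a + t) := by
    ext t; simp only [hardyDensity, deriv_comp_const_add]
  have e2 : hardyDensity p α (fun t => f (b - t)) (fun t => w (b - t)) =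
      fun t => hardyDensity p α f w (b - t) := by
    ext t; simp only [hardyDensity, deriv_comp_const_sub, abs_neg]
  have key1 := half_interval_hardy hp hq hα (h := fun t => f (a + t)) (w := fun t => w (a + t))
    (hf.comp (by fun_prop)) hδ hL0 (fun t ht => ha _ (by simpa using ht))
    (fun t ht htL => by
      have := hw (a + t) ⟨by linarith, by linarith⟩
      rwa [min_eq_left (by linarith), add_sub_cancel_left] at this)
    (by rw [e1]; exact (hi.comp_add_left a).intervalIntegrable)
  have key2 := half_interval_hardy hp hq hα (h := fun t => f (b - t)) (w := fun t => w (b - t))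
    (hf.comp (by fun_prop)) hδ hL0
    (fun t ht => hb _ (by simpa using ht))
    (fun t ht htL => by
      have := hw (b - t) ⟨by linarith, by linarith⟩
      rwa [min_eq_right (by linarith), sub_sub_cancel] at this)
    (by rw [e2]; exact (hi.comp_sub_left b).intervalIntegrable)
  have hm1 : a + L = (a + b) / 2 := by simp only [hL]; ring
  have hm2 : b - L = (a + b) / 2 := by simp only [hL]; ring
  rw [e1, intervalIntegral.integral_comp_add_left (fun t => hardyDensity p α f w t),
    intervalIntegral.integral_comp_add_left (fun t => |f t| ^ ((q - 1) / α)), add_zero,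
    hm1] at key1
  rw [e2, intervalIntegral.integral_comp_sub_left (fun t => hardyDensity p α f w t),
    intervalIntegral.integral_comp_sub_left (fun t => |f t| ^ ((q - 1) / α)), sub_zero,
    hm2] at key2
  have s1 := intervalIntegral.integral_add_adjacent_intervals
    (hi.intervalIntegrable (a := a) (b := (a + b) / 2)) (hi.intervalIntegrable (b := b))
  have s2 := intervalIntegral.integral_add_adjacent_intervals
    (hJi a ((a + b) / 2)) (hJi ((a + b) / 2) b)
  have j1 : 0 ≤ ∫ t in a..(a + b) / 2, |f t| ^ ((q - 1) / α) :=
    intervalIntegral.integral_nonneg (by linarith) fun _ _ => by positivity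
  have j2 : 0 ≤ ∫ t in (a + b) / 2..b, |f t| ^ ((q - 1) / α) :=
    intervalIntegral.integral_nonneg (by linarith) fun _ _ => by positivity
  obtain ⟨n1, k1⟩ := key1
  obtain ⟨n2, k2⟩ := key2
  have n3 : 0 ≤ ∫ t in a..b, hardyDensity p α f w t := by linarith
  refine ⟨n3, fun t ht => ?_⟩
  rcases le_total t ((a + b) / 2) with h' | h'
  · have := k1 (t - a) ⟨by linarith [ht.1], by linarith⟩
    rw [add_sub_cancel] at this
    refine this.trans ?_
    gcongr <;> linarith
  · have := k2 (b - t) ⟨by linarith [ht.2], by linarith⟩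
    rw [sub_sub_cancel] at this
    refine this.trans ?_
    gcongr <;> linarith

lemma exists_gap {F : Set ℝ} (hF : IsClosed F) {a b m : ℝ} (ha : a ∈ F) (hb : b ∈ F)
    (ham : a ≤ m) (hmb : m ≤ b) :
    ∃ a' ∈ F, ∃ b' ∈ F, a ≤ a' ∧ a' ≤ m ∧ m ≤ b' ∧ b' ≤ b ∧ Disjoint (Ioo a' b') F := by
  have h1 : IsCompact (F ∩ Icc a m) := isCompact_Icc.inter_left hF
  have h2 : IsCompact (F ∩ Icc m b) := isCompact_Icc.inter_left hF
  have n1 : (F ∩ Icc a m).Nonempty := ⟨a, ha, le_rfl, ham⟩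
  have n2 : (F ∩ Icc m b).Nonempty := ⟨b, hb, hmb, le_rfl⟩
  have m1 := h1.sSup_mem n1
  have m2 := h2.sInf_mem n2
  refine ⟨_, m1.1, _, m2.1, m1.2.1, m1.2.2, m2.2.1, m2.2.2, ?_⟩
  rw [Set.disjoint_left]
  intro s hs hsF
  rcases le_total s m with h | h
  · exact (hs.1.trans_le (le_csSup h1.bddAbove ⟨hsF, m1.2.1.trans hs.1.le, h⟩)).false
  · exact ((csInf_le h2.bddBelow ⟨hsF, h, hs.2.le.trans m2.2.2⟩).trans_lt hs.2).false

/-- `w` is dominated by `dist(·, F)^{-p}` at points `t` away from `F`. -/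
def IsHardyWeight (p : ℝ) (F : Set ℝ) (w : ℝ → ℝ) : Prop :=
  ∀ a b, Disjoint (Ioo a b) F → ∀ t ∈ Ioo a b, w t ≤ (min (t - a) (b - t)) ^ (-p)

section Line

variable {p q α δ : ℝ} {f w : ℝ → ℝ} {F : Set ℝ}

lemma gap_hardy_nonneg (hp : 2 ≤ p) (hα : α * p = p - 1)
    (hf : ContDiff ℝ 1 f) (hδ : 0 < δ) (hv : ∀ s ∈ F, ∀ t, |t - s| < δ → f t = 0)
    (hw : IsHardyWeight p F w) (hi : Integrable (hardyDensity p α f w))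
    {a b : ℝ} (ha : a ∈ F) (hb : b ∈ F) (hab : a ≤ b) (hd : Disjoint (Ioo a b) F) :
    0 ≤ ∫ t in a..b, hardyDensity p α f w t := by
  rcases hab.eq_or_lt with rfl | hab
  · simp
  · exact (interval_hardy hp one_lt_two hα hf hδ hab (hv a ha) (hv b hb) (hw a b hd) hi).1

lemma hardy_nonneg_of_mem (hp : 2 ≤ p) (hα : α * p = p - 1) (hF : IsClosed F)
    (hf : ContDiff ℝ 1 f) (hδ : 0 < δ) (hv : ∀ s ∈ F, ∀ t, |t - s| < δ → f t = 0)
    (hw : IsHardyWeight p F w) (hi : Integrable (hardyDensity p α f w)) (n : ℕ) :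
    ∀ {a b : ℝ}, a ∈ F → b ∈ F → a ≤ b → b - a ≤ n * (δ / 2) →
      0 ≤ ∫ t in a..b, hardyDensity p α f w t := by
  have hsmall : ∀ a ∈ F, ∀ c, a ≤ c → c ≤ a + δ / 2 →
      ∫ t in a..c, hardyDensity p α f w t = 0 := by
    intro a ha c hac hc
    rw [intervalIntegral.integral_congr (g := fun _ => (0 : ℝ)), intervalIntegral.integral_zero]
    intro t ht
    rw [uIcc_of_le hac] at ht
    refine hardyDensity_eq_zero (by linarith) w (hv a ha) ?_
    rw [abs_of_nonneg (by linarith [ht.1])]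
    linarith [ht.2]
  induction n with
  | zero =>
    intro a b ha hb hab h
    simp only [Nat.cast_zero, zero_mul, tsub_le_iff_right, zero_add] at h
    rw [le_antisymm hab h, intervalIntegral.integral_same]
  | succ n ih =>
    intro a b ha hb hab h
    rcases le_or_gt b (a + δ / 2) with h' | h'
    · exact (hsmall a ha b hab h').ge
    · obtain ⟨a', ha', b', hb', h1, h2, h3, h4, hd⟩ :=
        exists_gap hF ha hb (by linarith : a ≤ a + δ / 2) h'.le
      have i1 := hsmall a ha a' h1 h2
      have i2 := gap_hardy_nonneg hp hα hf hδ hv hw hi ha' hb' (h2.trans h3) hd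
      have i3 := ih hb' hb h4 (by push_cast at h; linarith)
      rw [← intervalIntegral.integral_add_adjacent_intervals
        (hi.intervalIntegrable (b := a')) (hi.intervalIntegrable (b := b)),
        ← intervalIntegral.integral_add_adjacent_intervals
        (hi.intervalIntegrable (b := b')) (hi.intervalIntegrable (b := b))]
      linarith

lemma integrable_hardyDensity (hp : 0 < p) (hf : ContDiff ℝ 1 f) (hfc : HasCompactSupport f)
    (hδ : 0 < δ) (hv : ∀ s ∈ F, ∀ t, |t - s| < δ → f t = 0)
    (hwm : Measurable w) (hw0 : ∀ t, 0 ≤ w t) (hw : IsHardyWeight p F w) :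
    Integrable (hardyDensity p α f w) := by
  have hcz (s : ℝ) (hs : 0 < s) (g : ℝ → ℝ) (hg : Continuous g) (hgc : HasCompactSupport g) :
      Integrable fun t => |g t| ^ s := by
    refine (hg.abs.rpow_const fun _ => Or.inr hs.le).integrable_of_hasCompactSupport ?_
    exact hgc.comp_left (g := fun x : ℝ => |x| ^ s) (by simp [Real.zero_rpow hs.ne'])
  have hfi := hcz p hp f hf.continuous hfc
  refine (hcz p hp _ (hf.continuous_deriv le_rfl) hfc.deriv).sub (Integrable.const_mul ?_ _)
  refine (hfi.mul_const (δ ^ (-p))).mono' ?_ (.of_forall fun t => ?_)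
  · exact ((hf.continuous.abs.rpow_const fun _ => Or.inr hp.le).measurable.mul
      hwm).aestronglyMeasurable
  · rw [Real.norm_of_nonneg (mul_nonneg (by positivity) (hw0 t))]
    rcases eq_or_ne (f t) 0 with h | h
    · simp [h, Real.zero_rpow hp.ne']
    · gcongr
      have := hw (t - δ) (t + δ) ?_ t ⟨by linarith, by linarith⟩
      · simpa using this
      · rw [Set.disjoint_left]
        intro s hs hsF
        exact h (hv s hsF t (abs_sub_lt_iff.2 ⟨by linarith [hs.1], by linarith [hs.2]⟩))

lemma line_hardy (hp : 2 ≤ p) (hq : 1 < q) (hα : α * p = p - 1) (hF : IsClosed F)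
    (hf : ContDiff ℝ 1 f) (hfc : HasCompactSupport f) (hδ : 0 < δ)
    (hv : ∀ s ∈ F, ∀ t, |t - s| < δ → f t = 0)
    (hwm : Measurable w) (hw0 : ∀ t, 0 ≤ w t) (hw : IsHardyWeight p F w) :
    0 ≤ (∫ t, hardyDensity p α f w t) ∧ ∀ t,
      |f t| ^ q ≤ hardyConst p q α * (∫ t, hardyDensity p α f w t) ^ (1 / p) *
        (∫ t, |f t| ^ ((q - 1) / α)) ^ α := by
  have hp0 : 0 < p := by linarith
  have hq0 : 0 < q := by linarith
  have hα0 : 0 < α := by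
    have : 0 < α * p := by rw [hα]; linarith
    exact (pos_iff_pos_of_mul_pos this).2 hp0
  have hs0 : 0 < (q - 1) / α := div_pos (by linarith) hα0
  have hC0 : 0 ≤ hardyConst p q α := by unfold hardyConst; positivity
  have hi := integrable_hardyDensity (α := α) hp0 hf hfc hδ hv hwm hw0 hw
  obtain ⟨R, hR0, hR⟩ : ∃ R : ℝ, 0 < R ∧ ∀ t, R ≤ |t| → f t = 0 := by
    obtain ⟨R, hR⟩ := hfc.isCompact.isBounded.subset_closedBall 0
    refine ⟨|R| + 1, by positivity, fun t ht => ?_⟩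
    by_contra h
    have := hR (subset_tsupport f h)
    rw [mem_closedBall, dist_zero_right, Real.norm_eq_abs] at this
    linarith [le_abs_self R]
  set S := R + δ with hS
  set F' : Set ℝ := F ∪ {-S, S} with hF'
  have hF'c : IsClosed F' := hF.union (Set.toFinite _).isClosed
  have hv' : ∀ s ∈ F', ∀ t, |t - s| < δ → f t = 0 := by
    rintro s (hs | rfl | rfl) t ht
    · exact hv s hs t ht
    · refine hR t ?_
      rw [abs_sub_lt_iff] at ht
      rw [abs_of_nonpos] <;> linarith
    · refine hR t ?_
      rw [abs_sub_lt_iff] at ht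
      rw [abs_of_nonneg] <;> linarith
  have hw' : IsHardyWeight p F' w := fun a b hd => hw a b (hd.mono_right subset_union_left)
  have hmS : -S ∈ F' := Or.inr (Or.inl rfl)
  have hpS : S ∈ F' := Or.inr (Or.inr rfl)
  have hge : ∀ {a b : ℝ}, a ∈ F' → b ∈ F' → a ≤ b →
      0 ≤ ∫ t in a..b, hardyDensity p α f w t := by
    intro a b ha hb hab
    obtain ⟨n, hn⟩ := exists_nat_ge ((b - a) / (δ / 2))
    exact hardy_nonneg_of_mem hp hα hF'c hf hδ hv' hw' hi n ha hb hab
      ((div_le_iff₀ (by positivity)).1 hn)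
  have htot : ∫ t, hardyDensity p α f w t = ∫ t in (-S)..S, hardyDensity p α f w t := by
    rw [intervalIntegral.integral_eq_integral_of_support_subset]
    intro t ht
    by_contra hc
    refine ht (hardyDensity_eq_zero (a := t) (δ := δ) hp0 w (fun s hs => hR s ?_) (by simpa))
    rw [mem_Ioc, not_and_or, not_lt, not_le] at hc
    rw [abs_sub_lt_iff] at hs
    rcases hc with hc | hc
    · rw [abs_of_nonpos] <;> linarith
    · rw [abs_of_nonneg] <;> linarith
  have hJi : Integrable fun t => |f t| ^ ((q - 1) / α) := by
    refine (hf.continuous.abs.rpow_const fun _ =>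
      Or.inr hs0.le).integrable_of_hasCompactSupport ?_
    exact hfc.comp_left (g := fun x : ℝ => |x| ^ ((q - 1) / α)) (by simp [Real.zero_rpow hs0.ne'])
  have hE0 : 0 ≤ ∫ t, hardyDensity p α f w t := by
    rw [htot]
    exact hge hmS hpS (by linarith)
  refine ⟨hE0, fun t => ?_⟩
  have hJ0 : 0 ≤ ∫ t, |f t| ^ ((q - 1) / α) := integral_nonneg fun _ => by positivity
  rcases eq_or_ne (f t) 0 with h | h
  · rw [h, abs_zero, Real.zero_rpow hq0.ne']
    positivity
  have htS : |t| < S := by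
    by_contra hc
    exact h (hR t (by linarith))
  obtain ⟨a, ha, b, hb, h1, h2, h3, h4, hd⟩ :=
    exists_gap hF'c hmS hpS (abs_lt.1 htS).1.le (abs_lt.1 htS).2.le
  have hab : a < b := by
    refine (h2.trans h3).lt_of_ne fun e => h (hv' a ha t ?_)
    rw [abs_sub_lt_iff]; constructor <;> linarith
  obtain ⟨k0, k⟩ := interval_hardy hp hq hα hf hδ hab (hv' a ha) (hv' b hb) (hw' a b hd) hi
  refine (k t ⟨h2, h3⟩).trans ?_
  have hE : ∫ t in a..b, hardyDensity p α f w t ≤ ∫ t, hardyDensity p α f w t := by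
    rw [htot, ← intervalIntegral.integral_add_adjacent_intervals
        (hi.intervalIntegrable (b := a)) (hi.intervalIntegrable (b := S)),
        ← intervalIntegral.integral_add_adjacent_intervals
        (hi.intervalIntegrable (b := b)) (hi.intervalIntegrable (b := S))]
    linarith [hge hmS ha h1, hge hb hpS h4]
  have hJ : ∫ t in a..b, |f t| ^ ((q - 1) / α) ≤ ∫ t, |f t| ^ ((q - 1) / α) := by
    rw [intervalIntegral.integral_of_le hab.le]
    exact setIntegral_le_integral hJi (.of_forall fun _ => by positivity)
  have hJ1 : 0 ≤ ∫ t in a..b, |f t| ^ ((q - 1) / α) :=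
    intervalIntegral.integral_nonneg hab.le fun _ _ => by positivity
  gcongr

end Line

lemma lintegral_piFinSuccAbove {n : ℕ} (i : Fin (n + 1)) {f : ℝ × (Fin n → ℝ) → ENNReal}
    (hf : Measurable f) :
    ∫⁻ x : Fin (n + 1) → ℝ, f (x i, i.removeNth x) = ∫⁻ y, ∫⁻ t, f (t, y) := by
  have := (volume_preserving_piFinSuccAbove (fun _ : Fin (n + 1) => ℝ) i).lintegral_comp hf
  rw [Measure.volume_eq_prod, lintegral_prod_symm _ hf.aemeasurable] at this
  exact this

/-- A form of the Loomis–Whitney inequality. -/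
lemma lintegral_rpow_le_of_le_removeNth {n : ℕ} (hn : 1 ≤ n)
    {ψ : (Fin (n + 1) → ℝ) → ENNReal} {G : Fin (n + 1) → (Fin n → ℝ) → ENNReal}
    (hG : ∀ i, Measurable (G i)) (h : ∀ i x, ψ x ≤ G i (i.removeNth x)) :
    ∫⁻ x, ψ x ^ ((n + 1 : ℝ) / n) ≤ (∑ i, ∫⁻ y, G i y) ^ ((n + 1 : ℝ) / n) := by
  have hn0 : (0 : ℝ) < n := by exact_mod_cast hn
  set φ : ℝ → ENNReal := (Icc (0 : ℝ) 1).indicator 1 with hφ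
  have hφm : Measurable φ := measurable_one.indicator measurableSet_Icc
  have hφ1 : ∫⁻ t, φ t = 1 := by
    simp [hφ, lintegral_indicator measurableSet_Icc]
  have hrm (i : Fin (n + 1)) : Measurable fun x : Fin (n + 1) → ℝ => i.removeNth x :=
    measurable_pi_lambda _ fun j => measurable_pi_apply _
  set f : (Fin (n + 1) → ℝ) → ENNReal := fun x => ∑ i, φ (x i) * G i (i.removeNth x) with hf
  have hfm : Measurable f := Finset.measurable_sum _ fun i _ =>
    (hφm.comp (measurable_pi_apply i)).mul ((hG i).comp (hrm i))
  have hconj : Real.HolderConjugate (Fintype.card (Fin (n + 1)) : ℝ) ((n + 1 : ℝ) / n) := by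
    rw [Fintype.card_fin, Real.holderConjugate_iff]
    push_cast
    refine ⟨by linarith, ?_⟩
    field_simp
    ring
  have key := lintegral_prod_lintegral_pow_le (fun _ : Fin (n + 1) => (volume : Measure ℝ)) hconj hfm
  have hlow (i : Fin (n + 1)) (x : Fin (n + 1) → ℝ) :
      ψ x ≤ ∫⁻ t, f (Function.update x i t) := by
    refine (h i x).trans ?_
    calc G i (i.removeNth x) = ∫⁻ t, φ t * G i (i.removeNth x) := by
          rw [lintegral_mul_const _ hφm, hφ1, one_mul]
      _ ≤ _ := by
          refine lintegral_mono fun t => ?_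
          have := Finset.single_le_sum (f := fun j => φ (Function.update x i t j) *
            G j (j.removeNth (Function.update x i t))) (fun j _ => zero_le) (Finset.mem_univ i)
          simpa [Fin.removeNth_update] using this
  have htot : ∫⁻ x, f x = ∑ i, ∫⁻ y, G i y := by
    refine (lintegral_finsetSum _ fun i _ =>
      (hφm.comp (measurable_pi_apply i)).mul ((hG i).comp (hrm i))).trans ?_
    refine Finset.sum_congr rfl fun i _ => ?_
    refine (lintegral_piFinSuccAbove i (f := fun z => φ z.1 * G i z.2)
      ((hφm.comp measurable_fst).mul ((hG i).comp measurable_snd))).trans ?_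
    refine lintegral_congr fun y => ?_
    change ∫⁻ t, φ t * G i y = G i y
    rw [lintegral_mul_const _ hφm, hφ1, one_mul]
  rw [← volume_pi, htot] at key
  refine le_trans (lintegral_mono fun x => ?_) key
  have e : ψ x ^ ((n + 1 : ℝ) / n) =
      ∏ _i : Fin (n + 1), ψ x ^ ((1 : ℝ) / ((Fintype.card (Fin (n + 1)) : ℝ) - 1)) := by
    rw [Finset.prod_const, Finset.card_univ, Fintype.card_fin, ← ENNReal.rpow_natCast,
      ← ENNReal.rpow_mul]
    congr 1
    push_cast
    rw [add_sub_cancel_right]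
    ring
  rw [e]
  refine Finset.prod_le_prod' fun i _ => ENNReal.rpow_le_rpow (hlow i x) ?_
  rw [Fintype.card_fin]
  push_cast
  rw [add_sub_cancel_right]
  positivity

section dirDist

variable {N : ℕ} {Ω : Set (EuclideanSpace ℝ (Fin N))}

lemma dirDist_nonneg (x e : EuclideanSpace ℝ (Fin N)) : 0 ≤ dirDist Ω x e :=
  Real.sInf_nonneg fun _ ⟨_, hr, _⟩ => hr ▸ abs_nonneg _

lemma dirDist_lt_iff (x e : EuclideanSpace ℝ (Fin N)) {r : ℝ} (hr : 0 < r) :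
    dirDist Ω x e < r ↔ (∀ t : ℝ, x + t • e ∉ Ωᶜ) ∨ ∃ t : ℝ, |t| < r ∧ x + t • e ∈ Ωᶜ := by
  rcases Set.eq_empty_or_nonempty {r : ℝ | ∃ t : ℝ, r = |t| ∧ x + t • e ∈ Ωᶜ} with h | h
  · have h' : ∀ t : ℝ, x + t • e ∉ Ωᶜ := fun t ht =>
      (Set.eq_empty_iff_forall_notMem.1 h) |t| ⟨t, rfl, ht⟩
    rw [dirDist, h, Real.sInf_empty]
    exact ⟨fun _ => Or.inl h', fun _ => hr⟩
  · have hb : BddBelow {r : ℝ | ∃ t : ℝ, r = |t| ∧ x + t • e ∈ Ωᶜ} :=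
      ⟨0, fun _ ⟨_, hr, _⟩ => hr ▸ abs_nonneg _⟩
    rw [dirDist, csInf_lt_iff hb h]
    constructor
    · rintro ⟨_, ⟨t, rfl, ht⟩, htr⟩
      exact Or.inr ⟨t, htr, ht⟩
    · rintro (h' | ⟨t, htr, ht⟩)
      · obtain ⟨_, t, _, ht⟩ := h
        exact absurd ht (h' t)
      · exact ⟨_, ⟨t, rfl, ht⟩, htr⟩

lemma isClosed_setOf_exists_abs_le (hΩ : IsOpen Ω) (r : ℝ) :
    IsClosed {z : EuclideanSpace ℝ (Fin N) × EuclideanSpace ℝ (Fin N) |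
      ∃ t : ℝ, |t| ≤ r ∧ z.1 + t • z.2 ∈ Ωᶜ} := by
  have hc : IsClosed {q : Icc (-r) r × (EuclideanSpace ℝ (Fin N) × EuclideanSpace ℝ (Fin N)) |
      q.2.1 + (q.1 : ℝ) • q.2.2 ∈ Ωᶜ} :=
    hΩ.isClosed_compl.preimage (by fun_prop)
  convert isClosedMap_snd_of_compactSpace _ hc using 1
  ext z
  constructor
  · rintro ⟨t, ht, hz⟩
    exact ⟨(⟨t, abs_le.1 ht⟩, z), hz, rfl⟩
  · rintro ⟨⟨t, z⟩, hz, rfl⟩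
    exact ⟨t, abs_le.2 t.2, hz⟩

lemma measurable_dirDist (hΩ : IsOpen Ω) :
    Measurable fun z : EuclideanSpace ℝ (Fin N) × EuclideanSpace ℝ (Fin N) =>
      dirDist Ω z.1 z.2 := by
  refine measurable_of_Iio fun r => ?_
  rcases le_or_gt r 0 with hr | hr
  · convert MeasurableSet.empty
    ext z
    simpa using hr.trans (dirDist_nonneg z.1 z.2)
  · have hA := fun ρ => (isClosed_setOf_exists_abs_le hΩ ρ).measurableSet
    convert (MeasurableSet.iUnion fun n : ℕ => hA n).compl.union
      (MeasurableSet.iUnion fun ρ : {ρ : ℚ // (ρ : ℝ) < r} => hA (ρ : ℚ)) using 1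
    ext z
    simp only [mem_preimage, mem_Iio, dirDist_lt_iff z.1 z.2 hr, mem_union, mem_compl_iff,
      mem_iUnion, mem_ofPred_eq, not_exists, not_and]
    refine or_congr ⟨fun h n t _ => h t, fun h t => ?_⟩ ⟨?_, ?_⟩
    · obtain ⟨n, hn⟩ := exists_nat_ge |t|
      exact h n t hn
    · rintro ⟨t, htr, ht⟩
      obtain ⟨ρ, h1, h2⟩ := exists_rat_btwn htr
      exact ⟨⟨ρ, h2⟩, t, h1.le, ht⟩
    · rintro ⟨ρ, t, htr, ht⟩
      exact ⟨t, htr.trans_lt ρ.2, ht⟩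

/-- The directional distance restricted to a line, raised to `-p`, is a Hardy weight. -/
lemma isHardyWeight_dirDist {p : ℝ} (hp : 0 < p) (z e : EuclideanSpace ℝ (Fin N)) :
    IsHardyWeight p {t : ℝ | z + t • e ∈ Ωᶜ} fun t => dirDist Ω (z + t • e) e ^ (-p) := by
  intro a b hab t ht
  have hm : 0 < min (t - a) (b - t) := lt_min (by linarith [ht.1]) (by linarith [ht.2])
  by_cases h : ∀ s : ℝ, z + t • e + s • e ∉ Ωᶜ
  · have : dirDist Ω (z + t • e) e = 0 := by
      have : {r : ℝ | ∃ s : ℝ, r = |s| ∧ z + t • e + s • e ∈ Ωᶜ} = ∅ :=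
        Set.eq_empty_iff_forall_notMem.2 fun _ ⟨s, _, hs⟩ => h s hs
      rw [dirDist, this, Real.sInf_empty]
    simp only [this]
    rw [Real.zero_rpow (by linarith)]
    positivity
  · have hle : min (t - a) (b - t) ≤ dirDist Ω (z + t • e) e := by
      rw [← not_lt, dirDist_lt_iff _ _ hm]
      rintro (h' | ⟨s, hs, hsΩ⟩)
      · exact h h'
      · have h1 : t + s ∈ Ioo a b := by
          have := abs_lt.1 hs
          have h2 := min_le_left (t - a) (b - t)
          have h3 := min_le_right (t - a) (b - t)
          constructor <;> linarith
        refine Set.disjoint_left.1 hab h1 ?_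
        rwa [mem_ofPred_eq, add_smul, ← add_assoc]
    exact Real.rpow_le_rpow_of_nonpos hm hle (by linarith)

lemma dirDist_rpow_neg_le {p δ : ℝ} (hp : 0 < p) (hδ : 0 < δ) {x e : EuclideanSpace ℝ (Fin N)}
    (he : ‖e‖ ≤ 1) (h : ∀ y ∈ Ωᶜ, δ ≤ dist x y) : dirDist Ω x e ^ (-p) ≤ δ ^ (-p) := by
  by_cases h' : ∀ t : ℝ, x + t • e ∉ Ωᶜ
  · have : {r : ℝ | ∃ s : ℝ, r = |s| ∧ x + s • e ∈ Ωᶜ} = ∅ :=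
      Set.eq_empty_iff_forall_notMem.2 fun _ ⟨s, _, hs⟩ => h' s hs
    rw [dirDist, this, Real.sInf_empty, Real.zero_rpow (by linarith)]
    positivity
  · have hle : δ ≤ dirDist Ω x e := by
      rw [← not_lt, dirDist_lt_iff _ _ hδ]
      rintro (h'' | ⟨s, hs, hsΩ⟩)
      · exact h' h''
      · have h1 := h _ hsΩ
        rw [dist_self_add_right, norm_smul, Real.norm_eq_abs] at h1
        nlinarith [abs_nonneg s]
    exact Real.rpow_le_rpow_of_nonpos hδ hle (by linarith)

end dirDist

/-- The directional version of the Hardy energy density. -/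
noncomputable def dirDensity {N : ℕ} (p α : ℝ) (Ω : Set (EuclideanSpace ℝ (Fin N)))
    (u : EuclideanSpace ℝ (Fin N) → ℝ) (x e : EuclideanSpace ℝ (Fin N)) : ℝ :=
  |fderiv ℝ u x e| ^ p - α ^ p * (|u x| ^ p * dirDist Ω x e ^ (-p))

section dirDensity

variable {N : ℕ} {p q α : ℝ} {Ω : Set (EuclideanSpace ℝ (Fin N))}
  {u : EuclideanSpace ℝ (Fin N) → ℝ}

lemma exists_pos_le_dist_compl (hΩ : IsOpen Ω) (huc : HasCompactSupport u) (hus : tsupport u ⊆ Ω) :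
    ∃ δ > 0, ∀ x ∈ tsupport u, ∀ y ∈ Ωᶜ, δ ≤ dist x y := by
  obtain ⟨δ, hδ, h⟩ := huc.isCompact.exists_thickening_subset_open hΩ hus
  refine ⟨δ, hδ, fun x hx y hy => ?_⟩
  by_contra! hlt
  exact hy (h (mem_thickening_iff.2 ⟨x, hx, by rwa [dist_comm]⟩))

lemma measurable_dirDensity (hΩ : IsOpen Ω) (hu : ContDiff ℝ 1 u) :
    Measurable fun z : EuclideanSpace ℝ (Fin N) × EuclideanSpace ℝ (Fin N) =>
      dirDensity p α Ω u z.1 z.2 := by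
  have h1 : Continuous fun z : EuclideanSpace ℝ (Fin N) × EuclideanSpace ℝ (Fin N) =>
      fderiv ℝ u z.1 z.2 :=
    ((hu.continuous_fderiv one_ne_zero).comp continuous_fst).clm_apply continuous_snd
  have h2 : Measurable fun z : EuclideanSpace ℝ (Fin N) × EuclideanSpace ℝ (Fin N) => u z.1 :=
    hu.continuous.measurable.comp measurable_fst
  have h3 := measurable_dirDist hΩ
  exact ((continuous_abs.measurable.comp h1.measurable).pow_const p).sub
    ((((continuous_abs.measurable.comp h2).pow_const p).mul (h3.pow_const (-p))).const_mul (α ^ p))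

lemma dirDensity_eq_zero (hp : 0 < p) {x : EuclideanSpace ℝ (Fin N)} (hx : x ∉ tsupport u)
    (e : EuclideanSpace ℝ (Fin N)) : dirDensity p α Ω u x e = 0 := by
  simp [dirDensity, fderiv_of_notMem_tsupport (𝕜 := ℝ) hx, image_eq_zero_of_notMem_tsupport hx,
    Real.zero_rpow hp.ne']

lemma exists_abs_dirDensity_le (hp : 0 < p) (hα : 0 ≤ α) (hΩ : IsOpen Ω) (hu : ContDiff ℝ 1 u)
    (huc : HasCompactSupport u) (hus : tsupport u ⊆ Ω) :
    ∃ C : ℝ, ∀ x e, ‖e‖ ≤ 1 → |dirDensity p α Ω u x e| ≤ (tsupport u).indicator (fun _ => C) x := by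
  obtain ⟨δ, hδ, h⟩ := exists_pos_le_dist_compl hΩ huc hus
  obtain ⟨A, hA⟩ := huc.exists_bound_of_continuous hu.continuous
  obtain ⟨B, hB⟩ := (huc.fderiv ℝ).exists_bound_of_continuous (hu.continuous_fderiv one_ne_zero)
  refine ⟨B ^ p + α ^ p * (A ^ p * δ ^ (-p)), fun x e he => ?_⟩
  by_cases hx : x ∈ tsupport u
  · rw [indicator_of_mem hx]
    have h1 : |fderiv ℝ u x e| ≤ B :=
      ((fderiv ℝ u x).le_of_opNorm_le (hB x) e).trans
        (mul_le_of_le_one_right ((norm_nonneg _).trans (hB x)) he)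
    have h2 : |u x| ≤ A := hA x
    have h3 := dirDist_rpow_neg_le hp hδ he (h x hx)
    have h4 := Real.rpow_le_rpow (abs_nonneg _) h1 hp.le
    have h5 := Real.rpow_le_rpow (abs_nonneg _) h2 hp.le
    have h6 : 0 ≤ |u x| ^ p * dirDist Ω x e ^ (-p) :=
      mul_nonneg (by positivity) (Real.rpow_nonneg (dirDist_nonneg x e) _)
    have h7 : |u x| ^ p * dirDist Ω x e ^ (-p) ≤ A ^ p * δ ^ (-p) :=
      mul_le_mul h5 h3 (Real.rpow_nonneg (dirDist_nonneg x e) _) ((by positivity : 0 ≤ |u x| ^ p).trans h5)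
    refine (abs_sub _ _).trans (add_le_add ?_ ?_)
    · rwa [abs_of_nonneg (by positivity)]
    · rw [abs_of_nonneg (by positivity)]
      gcongr
  · rw [dirDensity_eq_zero hp hx, indicator_of_notMem hx, abs_zero]

lemma integrable_dirDensity (hp : 0 < p) (hα : 0 ≤ α) (hΩ : IsOpen Ω) (hu : ContDiff ℝ 1 u)
    (huc : HasCompactSupport u) (hus : tsupport u ⊆ Ω) {e : EuclideanSpace ℝ (Fin N)}
    (he : ‖e‖ ≤ 1) : Integrable fun x => dirDensity p α Ω u x e := by
  obtain ⟨C, hC⟩ := exists_abs_dirDensity_le hp hα hΩ hu huc hus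
  refine Integrable.mono' (g := (tsupport u).indicator fun _ => C) ?_
    ((measurable_dirDensity hΩ hu).comp measurable_prodMk_right).aestronglyMeasurable
    (Filter.Eventually.of_forall fun x => hC x e he)
  exact (integrable_indicator_iff (isClosed_tsupport u).measurableSet).2
    (integrableOn_const huc.isCompact.measure_lt_top.ne)

lemma integrable_dirDensity_prod (hp : 0 < p) (hα : 0 ≤ α) (hΩ : IsOpen Ω) (hu : ContDiff ℝ 1 u)
    (huc : HasCompactSupport u) (hus : tsupport u ⊆ Ω)
    (σ : Measure (sphere (0 : EuclideanSpace ℝ (Fin N)) 1)) [IsFiniteMeasure σ] :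
    Integrable (fun z : EuclideanSpace ℝ (Fin N) × sphere (0 : EuclideanSpace ℝ (Fin N)) 1 =>
      dirDensity p α Ω u z.1 z.2) (volume.prod σ) := by
  obtain ⟨C, hC⟩ := exists_abs_dirDensity_le hp hα hΩ hu huc hus
  have hi : Integrable ((tsupport u).indicator fun _ => C) :=
    (integrable_indicator_iff (isClosed_tsupport u).measurableSet).2
      (integrableOn_const huc.isCompact.measure_lt_top.ne)
  refine Integrable.mono' (hi.comp_fst σ) ?_
    (Filter.Eventually.of_forall fun z => hC z.1 z.2 (by simp))
  exact ((measurable_dirDensity hΩ hu).comp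
    (measurable_fst.prodMk (measurable_subtype_coe.comp measurable_snd))).aestronglyMeasurable

lemma dirDensity_line (hp : 2 ≤ p) (hq : 1 < q) (hα : α * p = p - 1) (hΩ : IsOpen Ω)
    (hu : ContDiff ℝ 1 u) (huc : HasCompactSupport u) (hus : tsupport u ⊆ Ω)
    {e : EuclideanSpace ℝ (Fin N)} (he : ‖e‖ = 1) (z : EuclideanSpace ℝ (Fin N)) :
    0 ≤ (∫ t : ℝ, dirDensity p α Ω u (z + t • e) e) ∧ ∀ t : ℝ,
      |u (z + t • e)| ^ q ≤ hardyConst p q α *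
        (∫ t : ℝ, dirDensity p α Ω u (z + t • e) e) ^ (1 / p) *
        (∫ t : ℝ, |u (z + t • e)| ^ ((q - 1) / α)) ^ α := by
  obtain ⟨δ, hδ, h⟩ := exists_pos_le_dist_compl hΩ huc hus
  have hd (t : ℝ) : HasDerivAt (fun t : ℝ => z + t • e) e t := by
    simpa using ((hasDerivAt_id t).smul_const e).const_add z
  have hiso : Isometry fun t : ℝ => z + t • e := Isometry.of_dist_eq fun s t => by
    rw [dist_add_left, dist_eq_norm, ← sub_smul, norm_smul, he, mul_one, ← dist_eq_norm]
  have hdens (t : ℝ) : hardyDensity p α (fun t => u (z + t • e))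
      (fun t => dirDist Ω (z + t • e) e ^ (-p)) t = dirDensity p α Ω u (z + t • e) e := by
    have := ((hu.differentiable one_ne_zero (z + t • e)).hasFDerivAt.comp_hasDerivAt t (hd t)).deriv
    rw [hardyDensity, dirDensity, ← this]
    rfl
  have key := line_hardy (p := p) (q := q) (α := α) (δ := δ) (f := fun t => u (z + t • e))
    (w := fun t => dirDist Ω (z + t • e) e ^ (-p)) (F := {t : ℝ | z + t • e ∈ Ωᶜ}) hp hq hα
    (hΩ.isClosed_compl.preimage hiso.continuous)
    (hu.comp (contDiff_const.add (contDiff_id.smul contDiff_const)))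
    (huc.comp_isClosedEmbedding hiso.isClosedEmbedding) hδ ?_ ?_
    (fun t => Real.rpow_nonneg (dirDist_nonneg _ _) _) (isHardyWeight_dirDist (by linarith) z e)
  · simpa only [hdens] using key
  · intro s hs t hst
    by_contra h0
    have := h _ (subset_tsupport u h0) _ hs
    rw [hiso.dist_eq, Real.dist_eq] at this
    linarith
  · exact ((measurable_dirDist hΩ).comp
      (hiso.continuous.measurable.prodMk measurable_const)).pow_const _

end dirDensity

section Slice

variable {n : ℕ} {E : Type*} [NormedAddCommGroup E] [NormedSpace ℝ E] [MeasurableSpace E]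
  [BorelSpace E] {μ : Measure E} {κ : ENNReal}

/-- The parametrisation of a space by a coordinate direction and its complement. -/
noncomputable def slice (T : (Fin (n + 1) → ℝ) ≃L[ℝ] E) (i : Fin (n + 1))
    (z : ℝ × (Fin n → ℝ)) : E :=
  T (i.insertNth (α := fun _ => ℝ) z.1 z.2)

variable (T : (Fin (n + 1) → ℝ) ≃L[ℝ] E) (i : Fin (n + 1))

omit [MeasurableSpace E] [BorelSpace E] in
lemma slice_eq (t : ℝ) (y : Fin n → ℝ) :
    slice T i (t, y) = slice T i (0, y) + t • T (Pi.single i 1) := by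
  rw [slice, slice, ← map_smul, ← map_add]
  congr 1
  funext j
  refine Fin.succAboveCases i ?_ (fun k => ?_) j
  · simp
  · simp

lemma measurableEmbedding_slice : MeasurableEmbedding (slice T i) :=
  T.toHomeomorph.measurableEmbedding.comp
    (MeasurableEquiv.piFinSuccAbove (fun _ : Fin (n + 1) => ℝ) i).symm.measurableEmbedding

lemma map_slice (hT : Measure.map T volume = κ • μ) :
    Measure.map (slice T i) (volume.prod volume) = κ • μ := by
  have h := (volume_preserving_piFinSuccAbove (fun _ : Fin (n + 1) => ℝ) i).symm.map_eq
  rw [← hT, ← h, Measure.map_map T.continuous.measurable (MeasurableEquiv.measurable _)]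
  rfl

lemma integrable_integral_slice (hT : Measure.map T volume = κ • μ) (hκ : κ ≠ ⊤) {Φ : E → ℝ}
    (hΦ : Integrable Φ μ) :
    Integrable (fun y => ∫ t, Φ (slice T i (t, y))) ∧
      ∫ y, ∫ t, Φ (slice T i (t, y)) = κ.toReal * ∫ x, Φ x ∂μ := by
  have h1 : Integrable (Φ ∘ slice T i) (volume.prod volume) := by
    rw [← (measurableEmbedding_slice T i).integrable_map_iff, map_slice T i hT]
    exact hΦ.smul_measure hκ
  refine ⟨h1.integral_prod_right, ?_⟩
  refine (integral_prod_symm _ h1).symm.trans ?_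
  rw [← smul_eq_mul, ← integral_smul_measure, ← map_slice T i hT,
    (measurableEmbedding_slice T i).integral_map]
  rfl

end Slice

/-- Absorbing the norm on the right-hand side of the Gagliardo–Nirenberg–Sobolev iteration. -/
lemma rpow_le_of_le_absorb {m p α B Y X : ℝ} (hm : 0 < m) (hp : 0 < p) (hpm : p < m + 1)
    (hα : α * p = p - 1) (hB : 0 ≤ B) (hY : 0 ≤ Y) (hX : 0 ≤ X)
    (h : X ≤ (B * Y ^ (1 / p) * X ^ α) ^ ((m + 1) / m)) :
    X ^ ((m + 1 - p) / (m + 1)) ≤ B ^ p * Y := by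
  rcases hX.eq_or_lt with rfl | hX
  · rw [Real.zero_rpow (div_pos (by linarith) (by linarith)).ne']
    positivity
  · have hα' : α = (p - 1) / p := by field_simp; exact hα
    have h1 : X ^ (m / (m + 1)) ≤ B * Y ^ (1 / p) * X ^ α := by
      have := Real.rpow_le_rpow hX.le h (by positivity : 0 ≤ m / (m + 1))
      rwa [← Real.rpow_mul (by positivity), div_mul_div_comm, mul_comm (m + 1), div_self (by positivity),
        Real.rpow_one] at this
    have h2 : X ^ (m / (m + 1) - α) ≤ B * Y ^ (1 / p) := by
      rw [Real.rpow_sub hX]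
      exact (div_le_iff₀ (by positivity)).2 h1
    have h3 := Real.rpow_le_rpow (by positivity) h2 hp.le
    rw [← Real.rpow_mul hX.le, Real.mul_rpow hB (by positivity), ← Real.rpow_mul hY,
      one_div_mul_cancel hp.ne', Real.rpow_one] at h3
    convert h3 using 2
    rw [hα']
    field_simp
    ring

lemma lintegral_rpow_mul_rpow_le {Y : Type*} [MeasurableSpace Y] {ν : Measure Y} {p α : ℝ}
    (hp : 1 < p) (hα : α * p = p - 1) {f g : Y → ENNReal} (hf : Measurable f) (hg : Measurable g) :
    ∫⁻ y, f y ^ (1 / p) * g y ^ α ∂ν ≤ (∫⁻ y, f y ∂ν) ^ (1 / p) * (∫⁻ y, g y ∂ν) ^ α := by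
  have hp0 : 0 < p := by linarith
  have hα' : α = (p - 1) / p := by field_simp; exact hα
  have hα0 : α ≠ 0 := by rw [hα']; exact (div_pos (by linarith) hp0).ne'
  have hc : p.HolderConjugate (1 / α) := by
    rw [Real.holderConjugate_iff]
    refine ⟨hp, ?_⟩
    rw [one_div, inv_inv, hα']
    field_simp
    ring
  have := ENNReal.lintegral_mul_le_Lp_mul_Lq ν hc (hf.pow_const (1 / p)).aemeasurable
    (hg.pow_const α).aemeasurable
  simpa only [Pi.mul_apply, ← ENNReal.rpow_mul, one_div_mul_cancel hp0.ne', one_div_one_div,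
    mul_one_div_cancel hα0, ENNReal.rpow_one] using this

section GNS

variable {n : ℕ} {p α : ℝ} {Ω : Set (EuclideanSpace ℝ (Fin (n + 1)))}
  {u : EuclideanSpace ℝ (Fin (n + 1)) → ℝ} {κ : ENNReal}
  (T : (Fin (n + 1) → ℝ) ≃L[ℝ] EuclideanSpace ℝ (Fin (n + 1)))

lemma integral_dirDensity_nonneg_of_equiv (hp : 2 ≤ p) (hα : α * p = p - 1) (hΩ : IsOpen Ω)
    (hu : ContDiff ℝ 1 u) (huc : HasCompactSupport u) (hus : tsupport u ⊆ Ω)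
    (hT : Measure.map T volume = κ • volume) (hκ0 : κ ≠ 0) (hκ : κ ≠ ⊤) {i : Fin (n + 1)}
    (hi : ‖T (Pi.single i 1)‖ = 1) :
    0 ≤ ∫ x, dirDensity p α Ω u x (T (Pi.single i 1)) := by
  have hα0 : 0 ≤ α := by
    by_contra! h
    nlinarith
  have h := (integrable_integral_slice T i hT hκ
    (integrable_dirDensity (p := p) (by linarith) hα0 hΩ hu huc hus hi.le)).2
  have h0 : 0 ≤ κ.toReal * ∫ x, dirDensity p α Ω u x (T (Pi.single i 1)) := by
    rw [← h]
    refine integral_nonneg fun y => ?_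
    refine (integral_congr_ae (Filter.Eventually.of_forall fun t => ?_)).subst
      (motive := fun s => 0 ≤ s)
      (dirDensity_line hp one_lt_two hα hΩ hu huc hus hi (slice T i (0, y))).1
    beta_reduce
    rw [← slice_eq T i t y]
  exact nonneg_of_mul_nonneg_right h0 (ENNReal.toReal_pos hκ0 hκ)

lemma gns_of_equiv (hn : 1 ≤ n) (hp : 2 ≤ p) (hpn : p < n + 1) (hα : α * p = p - 1) (hΩ : IsOpen Ω)
    (hu : ContDiff ℝ 1 u) (huc : HasCompactSupport u) (hus : tsupport u ⊆ Ω)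
    (hT : Measure.map T volume = κ • volume) (hκ0 : κ ≠ 0) (hκ : κ ≠ ⊤)
    (hi : ∀ i, ‖T (Pi.single i 1)‖ = 1) {M : ℝ}
    (hM : ∀ i, ∫ x, dirDensity p α Ω u x (T (Pi.single i 1)) ≤ M) :
    (κ.toReal * ∫ x, |u x| ^ ((n + 1 : ℝ) * p / (n + 1 - p))) ^ ((n + 1 - p) / (n + 1 : ℝ)) ≤
      ((n + 1) * hardyConst p (p * n / (n + 1 - p)) α) ^ p * (κ.toReal * M) := by
  have hn0 : (0 : ℝ) < n := by exact_mod_cast hn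
  have hp0 : 0 < p := by linarith
  have hα' : α = (p - 1) / p := by field_simp; exact hα
  have hα0 : 0 < α := by rw [hα']; exact div_pos (by linarith) hp0
  have hd : 0 < n + 1 - p := by linarith
  set r : ℝ := (n + 1 : ℝ) * p / (n + 1 - p) with hr
  set q : ℝ := p * n / (n + 1 - p) with hq
  have hr0 : 0 < r := by positivity
  have hq1 : 1 < q := by
    rw [hq, lt_div_iff₀ hd]
    nlinarith
  have hqr : (q - 1) / α = r := by
    have : p - 1 ≠ 0 := by linarith
    rw [hq, hr, hα']
    field_simp
    ring
  have hqn : q * ((n + 1) / n) = r := by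
    rw [hq, hr]
    field_simp
  set C := hardyConst p q α with hC
  have hC0 : 0 ≤ C := by rw [hC]; unfold hardyConst; positivity
  set e : Fin (n + 1) → EuclideanSpace ℝ (Fin (n + 1)) := fun i => T (Pi.single i 1) with he
  set Φ : Fin (n + 1) → EuclideanSpace ℝ (Fin (n + 1)) → ℝ :=
    fun i x => dirDensity p α Ω u x (e i) with hΦ
  have hΦm (i) : Measurable (Φ i) := (measurable_dirDensity hΩ hu).comp measurable_prodMk_right
  have hΦi (i) : Integrable (Φ i) := integrable_dirDensity hp0 hα0.le hΩ hu huc hus (hi i).le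
  have hum : Continuous fun x => |u x| ^ r :=
    hu.continuous.abs.rpow_const fun _ => Or.inr hr0.le
  have hui : Integrable fun x => |u x| ^ r := hum.integrable_of_hasCompactSupport
    (huc.comp_left (g := fun x : ℝ => |x| ^ r) (by simp [Real.zero_rpow hr0.ne']))
  set 𝓔 : Fin (n + 1) → (Fin n → ℝ) → ℝ := fun i y => ∫ t, Φ i (slice T i (t, y)) with h𝓔
  set J : Fin (n + 1) → (Fin n → ℝ) → ℝ := fun i y => ∫ t, |u (slice T i (t, y))| ^ r with hJ
  have hline (i y) : 0 ≤ 𝓔 i y ∧ ∀ t : ℝ,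
      |u (slice T i (t, y))| ^ q ≤ C * 𝓔 i y ^ (1 / p) * J i y ^ α := by
    have := dirDensity_line hp hq1 hα hΩ hu huc hus (hi i) (slice T i (0, y))
    have hs (t : ℝ) : slice T i (t, y) = slice T i (0, y) + t • e i := slice_eq T i t y
    have e1 : 𝓔 i y = ∫ t : ℝ, dirDensity p α Ω u (slice T i (0, y) + t • e i) (e i) := by
      refine integral_congr_ae (Filter.Eventually.of_forall fun t => ?_)
      simp only [hΦ]
      rw [hs t]
    have e2 : J i y = ∫ t : ℝ, |u (slice T i (0, y) + t • e i)| ^ r := by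
      refine integral_congr_ae (Filter.Eventually.of_forall fun t => ?_)
      beta_reduce
      rw [hs t]
    rw [hqr, ← e1, ← e2] at this
    refine ⟨this.1, fun t => ?_⟩
    rw [hs t]
    exact this.2 t
  have hJ0 (i y) : 0 ≤ J i y := integral_nonneg fun t => by positivity
  have hsm (i) : Measurable (slice T i) := (measurableEmbedding_slice T i).measurable
  have h𝓔m (i) : Measurable (𝓔 i) :=
    (StronglyMeasurable.integral_prod_left' (μ := volume)
      ((hΦm i).comp (hsm i)).stronglyMeasurable).measurable
  have hJm (i) : Measurable (J i) :=
    (StronglyMeasurable.integral_prod_left' (μ := volume)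
      (hum.measurable.comp (hsm i)).stronglyMeasurable).measurable
  have hEint (i) := integrable_integral_slice T i hT hκ (hΦi i)
  have hJint (i) := integrable_integral_slice T i hT hκ hui
  set I := ∫ x, |u x| ^ r with hI
  have hI0 : 0 ≤ I := integral_nonneg fun x => by positivity
  set G : Fin (n + 1) → (Fin n → ℝ) → ENNReal := fun i y => ENNReal.ofReal C *
    (ENNReal.ofReal (𝓔 i y) ^ (1 / p) * ENNReal.ofReal (J i y) ^ α) with hG
  have hGm (i) : Measurable (G i) :=
    (((h𝓔m i).ennreal_ofReal.pow_const _).mul ((hJm i).ennreal_ofReal.pow_const _)).const_mul _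
  have hM0 : 0 ≤ M := (integral_dirDensity_nonneg_of_equiv T hp hα hΩ hu huc hus hT hκ0 hκ (hi 0)).trans
    (hM 0)
  have hG1 (i) : ∫⁻ y, G i y ≤ ENNReal.ofReal
      (C * ((κ.toReal * M) ^ (1 / p) * (κ.toReal * I) ^ α)) := by
    rw [lintegral_const_mul (f := fun y => ENNReal.ofReal (𝓔 i y) ^ (1 / p) *
      ENNReal.ofReal (J i y) ^ α) _ (((h𝓔m i).ennreal_ofReal.pow_const _).mul
      ((hJm i).ennreal_ofReal.pow_const _)), ENNReal.ofReal_mul hC0,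
      ENNReal.ofReal_mul (by positivity),
      ← ENNReal.ofReal_rpow_of_nonneg (by positivity) (by positivity),
      ← ENNReal.ofReal_rpow_of_nonneg (by positivity) hα0.le]
    refine mul_le_mul_right ((lintegral_rpow_mul_rpow_le (by linarith) hα (h𝓔m i).ennreal_ofReal
      (hJm i).ennreal_ofReal).trans ?_) _
    rw [← ofReal_integral_eq_lintegral_ofReal (hEint i).1
        (Filter.Eventually.of_forall fun y => (hline i y).1),
      ← ofReal_integral_eq_lintegral_ofReal (hJint i).1 (Filter.Eventually.of_forall (hJ0 i)),
      (hEint i).2, (hJint i).2]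
    gcongr
    exact hM i
  set ψ : (Fin (n + 1) → ℝ) → ENNReal := fun x => ENNReal.ofReal (|u (T x)| ^ q) with hψ
  have hψG (i x) : ψ x ≤ G i (i.removeNth x) := by
    have hx : T x = slice T i (x i, i.removeNth x) := by
      rw [slice, Fin.insertNth_self_removeNth]
    simp only [hψ, hG]
    rw [ENNReal.ofReal_rpow_of_nonneg (hline i _).1 (by positivity),
      ENNReal.ofReal_rpow_of_nonneg (hJ0 i _) hα0.le,
      ← ENNReal.ofReal_mul (Real.rpow_nonneg (hline i _).1 _), ← ENNReal.ofReal_mul hC0, ← mul_assoc,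
      hx]
    exact ENNReal.ofReal_le_ofReal ((hline i _).2 _)
  have hLW := lintegral_rpow_le_of_le_removeNth hn hGm hψG
  have hψI : ∫⁻ x, ψ x ^ ((n + 1 : ℝ) / n) = ENNReal.ofReal (κ.toReal * I) := by
    have e1 (x) : ψ x ^ ((n + 1 : ℝ) / n) = ENNReal.ofReal (|u (T x)| ^ r) := by
      simp only [hψ]
      rw [ENNReal.ofReal_rpow_of_nonneg (by positivity) (by positivity),
        ← Real.rpow_mul (abs_nonneg _), hqn]
    simp only [e1]
    have e2 := T.toHomeomorph.measurableEmbedding.lintegral_map (μ := volume)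
      (fun x => ENNReal.ofReal (|u x| ^ r))
    refine e2.symm.trans ?_
    change ∫⁻ x, ENNReal.ofReal (|u x| ^ r) ∂(Measure.map T volume) = _
    rw [hT, lintegral_smul_measure, ← ofReal_integral_eq_lintegral_ofReal hui
      (Filter.Eventually.of_forall fun x => by positivity), ENNReal.ofReal_mul ENNReal.toReal_nonneg,
      ENNReal.ofReal_toReal hκ, smul_eq_mul]
  have hsum : ∑ i, ∫⁻ y, G i y ≤ ENNReal.ofReal
      (((n + 1) * C) * (κ.toReal * M) ^ (1 / p) * (κ.toReal * I) ^ α) := by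
    refine (Finset.sum_le_sum fun i _ => hG1 i).trans_eq ?_
    rw [Finset.sum_const, Finset.card_univ, Fintype.card_fin, ← ENNReal.ofReal_nsmul, nsmul_eq_mul]
    push_cast
    congr 1
    ring
  have hfin := hLW.trans (ENNReal.rpow_le_rpow hsum (by positivity))
  rw [hψI, ENNReal.ofReal_rpow_of_nonneg (by positivity) (by positivity),
    ENNReal.ofReal_le_ofReal_iff (by positivity)] at hfin
  exact rpow_le_of_le_absorb hn0 hp0 hpn hα (by positivity) (by positivity) (by positivity) hfin

end GNS

section Frame

variable {N : ℕ}

lemma exists_equiv_of_det_ne_zero {e : Fin N → EuclideanSpace ℝ (Fin N)}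
    (he : (Matrix.of fun i j => e j i).det ≠ 0) :
    ∃ T : (Fin N → ℝ) ≃L[ℝ] EuclideanSpace ℝ (Fin N), (∀ i, T (Pi.single i 1) = e i) ∧
      Measure.map T volume =
        ENNReal.ofReal |(Matrix.of fun i j => e j i).det⁻¹| • volume := by
  set M : Matrix (Fin N) (Fin N) ℝ := Matrix.of fun i j => e j i with hM
  let S := (Matrix.toLinearEquiv' M (Matrix.invertibleOfIsUnitDet M he.isUnit))
  let S' : (Fin N → ℝ) ≃L[ℝ] (Fin N → ℝ) := S.toContinuousLinearEquiv
  let L : (Fin N → ℝ) ≃L[ℝ] EuclideanSpace ℝ (Fin N) :=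
    (PiLp.continuousLinearEquiv 2 ℝ fun _ : Fin N => ℝ).symm
  have hS (x) : S' x = M.mulVec x := rfl
  refine ⟨S'.trans L, fun i => ?_, ?_⟩
  · ext j
    change S' (Pi.single i 1) j = _
    rw [hS]
    simp [hM]
  · have h1 : Measure.map S' volume = ENNReal.ofReal |M.det⁻¹| • volume :=
      Real.map_matrix_volume_pi_eq_smul_volume_pi he
    have h2 : Measure.map L volume = volume := (PiLp.volume_preserving_toLp (Fin N)).map_eq
    have h3 : ⇑(S'.trans L) = L ∘ S' := rfl
    rw [h3, ← Measure.map_map L.continuous.measurable S'.continuous.measurable, h1,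
      Measure.map_smul, h2]

lemma exists_pos_half_le_det (N : ℕ) : ∃ ε > 0, ∀ e : Fin N → EuclideanSpace ℝ (Fin N),
    (∀ i, dist (e i) (EuclideanSpace.single i 1) < ε) →
      1 / 2 < (Matrix.of fun i j => e j i).det := by
  have hc : Continuous fun e : Fin N → EuclideanSpace ℝ (Fin N) =>
      (Matrix.of fun i j => e j i).det := by
    refine Continuous.matrix_det (continuous_matrix fun i j => ?_)
    simp only [Matrix.of_apply]
    fun_prop
  have h1 : (Matrix.of fun i j : Fin N => (EuclideanSpace.single j (1 : ℝ)) i).det = 1 := by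
    have : (Matrix.of fun i j : Fin N => (EuclideanSpace.single j (1 : ℝ)) i) = 1 := by
      ext i j
      simp [Matrix.one_apply]
    rw [this, Matrix.det_one]
  have ho : IsOpen {e : Fin N → EuclideanSpace ℝ (Fin N) |
      1 / 2 < (Matrix.of fun i j => e j i).det} := isOpen_lt continuous_const hc
  obtain ⟨ε, hε, h⟩ := Metric.isOpen_iff.1 ho (fun i => EuclideanSpace.single i 1) (by
    change 1 / 2 < (Matrix.of fun i j : Fin N => (EuclideanSpace.single j (1 : ℝ)) i).det
    rw [h1]
    norm_num)
  exact ⟨ε, hε, fun e he => h ((dist_pi_lt_iff hε).2 he)⟩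

end Frame

section Average

variable {n : ℕ} {p α : ℝ}

lemma integral_dirDensity_nonneg (hp : 2 ≤ p) (hα : α * p = p - 1)
    {Ω : Set (EuclideanSpace ℝ (Fin (n + 1)))} {u : EuclideanSpace ℝ (Fin (n + 1)) → ℝ}
    (hΩ : IsOpen Ω) (hu : ContDiff ℝ 1 u) (huc : HasCompactSupport u) (hus : tsupport u ⊆ Ω)
    {e : EuclideanSpace ℝ (Fin (n + 1))} (he : ‖e‖ = 1) :
    0 ≤ ∫ x, dirDensity p α Ω u x e := by
  have he0 : e ≠ 0 := by
    rintro rfl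
    simp at he
  obtain ⟨A, hA⟩ := SeparatingDual.exists_continuousLinearEquiv_apply_eq (R := ℝ)
    (x := (EuclideanSpace.single 0 1 : EuclideanSpace ℝ (Fin (n + 1)))) (y := e) (by simp) he0
  let L : (Fin (n + 1) → ℝ) ≃L[ℝ] EuclideanSpace ℝ (Fin (n + 1)) :=
    (PiLp.continuousLinearEquiv 2 ℝ fun _ : Fin (n + 1) => ℝ).symm
  have h1 : (L.trans A) (Pi.single 0 1) = e := hA
  have hdet : LinearMap.det (A : EuclideanSpace ℝ (Fin (n + 1)) →ₗ[ℝ] _) ≠ 0 :=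
    (LinearEquiv.isUnit_det' A.toLinearEquiv).ne_zero
  have h2 : Measure.map L volume = volume := (PiLp.volume_preserving_toLp (Fin (n + 1))).map_eq
  have h3 : Measure.map (L.trans A) volume = ENNReal.ofReal
      |(LinearMap.det (A : EuclideanSpace ℝ (Fin (n + 1)) →ₗ[ℝ] _))⁻¹| • volume := by
    have : ⇑(L.trans A) = A ∘ L := rfl
    rw [this, ← Measure.map_map A.continuous.measurable L.continuous.measurable, h2]
    exact Measure.map_linearMap_addHaar_eq_smul_addHaar volume hdet
  have := integral_dirDensity_nonneg_of_equiv (L.trans A) hp hα hΩ hu huc hus h3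
    (by simpa using hdet) ENNReal.ofReal_ne_top (i := 0) (by rw [h1, he])
  rwa [h1] at this

lemma exists_gns_sphere (hn : 1 ≤ n) (hp : 2 ≤ p) (hpn : p < n + 1) (hα : α * p = p - 1) :
    ∃ K : ℝ, 0 < K ∧ ∀ (Ω : Set (EuclideanSpace ℝ (Fin (n + 1))))
      (u : EuclideanSpace ℝ (Fin (n + 1)) → ℝ), IsOpen Ω → ContDiff ℝ 1 u → HasCompactSupport u →
      tsupport u ⊆ Ω →
      K * (∫ x, |u x| ^ ((n + 1 : ℝ) * p / (n + 1 - p))) ^ ((n + 1 - p) / (n + 1 : ℝ)) ≤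
        ∫ e : sphere (0 : EuclideanSpace ℝ (Fin (n + 1))) 1, ∫ x, dirDensity p α Ω u x e
          ∂volume ∂(volume : Measure (EuclideanSpace ℝ (Fin (n + 1)))).toSphere := by
  have hp0 : 0 < p := by linarith
  have hα0 : 0 ≤ α := by
    by_contra! h
    nlinarith
  obtain ⟨ε, hε, hdet⟩ := exists_pos_half_le_det (n + 1)
  set σ := (volume : Measure (EuclideanSpace ℝ (Fin (n + 1)))).toSphere with hσ
  let b (i : Fin (n + 1)) : sphere (0 : EuclideanSpace ℝ (Fin (n + 1))) 1 :=
    ⟨EuclideanSpace.single i 1, by simp⟩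
  have hb (i) : 0 < σ.real (ball (b i) ε) :=
    ENNReal.toReal_pos (isOpen_ball.measure_pos σ ⟨b i, mem_ball_self hε⟩).ne' (measure_ne_top _ _)
  set c : ℝ := ∑ i, (σ.real (ball (b i) ε))⁻¹ with hc
  set A : ℝ := ((n + 1) * hardyConst p (p * n / (n + 1 - p)) α) ^ p with hA
  set s : ℝ := (n + 1 - p) / (n + 1 : ℝ) with hs
  have hn0 : (0 : ℝ) < n + 1 := by positivity
  have hs1 : 0 ≤ 1 - s := by
    rw [hs, sub_nonneg, div_le_one hn0]
    linarith
  have hc0 : 0 ≤ c := Finset.sum_nonneg fun i _ => (inv_pos.2 (hb i)).le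
  have hA0 : 0 ≤ A := by
    refine Real.rpow_nonneg (mul_nonneg hn0.le ?_) _
    unfold hardyConst
    have : 0 ≤ p * n / (n + 1 - p) := div_nonneg (by positivity) (by linarith)
    positivity
  refine ⟨(A * 2 ^ (1 - s) * c + 1)⁻¹, by positivity, fun Ω u hΩ hu huc hus => ?_⟩
  set P : sphere (0 : EuclideanSpace ℝ (Fin (n + 1))) 1 → ℝ :=
    fun e => ∫ x, dirDensity p α Ω u x e with hP
  have hPi : Integrable P σ := (integrable_dirDensity_prod hp0 hα0 hΩ hu huc hus σ).integral_prod_right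
  have hP0 (e) : 0 ≤ P e := integral_dirDensity_nonneg hp hα hΩ hu huc hus (by simp)
  have hPI : 0 ≤ ∫ e, P e ∂σ := integral_nonneg hP0
  have hex (i) : ∃ e ∈ ball (b i) ε, P e ≤ (σ.real (ball (b i) ε))⁻¹ * ∫ e, P e ∂σ := by
    obtain ⟨e, he, hle⟩ := exists_le_setAverage
      (isOpen_ball.measure_pos σ ⟨b i, mem_ball_self hε⟩).ne' (measure_ne_top σ _)
      (hPi.integrableOn (s := ball (b i) ε))
    refine ⟨e, he, hle.trans ?_⟩
    rw [setAverage_eq, smul_eq_mul]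
    exact mul_le_mul_of_nonneg_left
      (setIntegral_le_integral hPi (Filter.Eventually.of_forall hP0)) (inv_pos.2 (hb i)).le
  choose e heb heP using hex
  have hd := hdet (fun i => e i) fun i => heb i
  obtain ⟨T, hT, hmap⟩ := exists_equiv_of_det_ne_zero (e := fun i => (e i : EuclideanSpace ℝ _))
    (by linarith)
  set D := (Matrix.of fun i j => (e j : EuclideanSpace ℝ (Fin (n + 1))) i).det with hD
  have hD0 : 0 < D := by linarith
  have hκ : (ENNReal.ofReal |D⁻¹|).toReal = D⁻¹ := by
    rw [ENNReal.toReal_ofReal (abs_nonneg _), abs_of_pos (inv_pos.2 hD0)]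
  have hD2 : D⁻¹ ≤ 2 := by
    rw [inv_le_comm₀ hD0 two_pos]
    linarith
  have key := gns_of_equiv T hn hp hpn hα hΩ hu huc hus hmap
    (by simpa using hD0.ne') ENNReal.ofReal_ne_top
    (fun i => by rw [hT i]; simp) (M := c * ∫ e, P e ∂σ) (fun i => by
      rw [hT i]
      refine (heP i).trans (mul_le_mul_of_nonneg_right ?_ hPI)
      exact Finset.single_le_sum (f := fun i => (σ.real (ball (b i) ε))⁻¹)
        (fun i _ => (inv_pos.2 (hb i)).le) (Finset.mem_univ i))
  rw [hκ, ← hA, ← hs] at key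
  set I := ∫ x, |u x| ^ ((n + 1 : ℝ) * p / (n + 1 - p)) with hI
  have hI0 : 0 ≤ I := integral_nonneg fun x => by positivity
  have hDi : 0 < D⁻¹ := inv_pos.2 hD0
  have h1 : I ^ s ≤ A * (D⁻¹) ^ (1 - s) * (c * ∫ e, P e ∂σ) := by
    rw [Real.mul_rpow hDi.le hI0] at key
    rw [Real.rpow_sub hDi, Real.rpow_one]
    have h2 : 0 < D⁻¹ ^ s := by positivity
    calc I ^ s = (D⁻¹ ^ s * I ^ s) / D⁻¹ ^ s := by field_simp
      _ ≤ (A * (D⁻¹ * (c * ∫ e, P e ∂σ))) / D⁻¹ ^ s := by gcongr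
      _ = _ := by ring
  have h2 : I ^ s ≤ (A * 2 ^ (1 - s) * c + 1) * ∫ e, P e ∂σ := by
    refine h1.trans ?_
    have : D⁻¹ ^ (1 - s) ≤ 2 ^ (1 - s) := Real.rpow_le_rpow hDi.le hD2 hs1
    calc A * (D⁻¹) ^ (1 - s) * (c * ∫ e, P e ∂σ) ≤ A * 2 ^ (1 - s) * (c * ∫ e, P e ∂σ) := by gcongr
      _ ≤ _ := by linarith
  rw [inv_mul_le_iff₀ (by positivity)]
  exact h2

end Average

lemma integral_abs_rpow_mul_exp_neg_sq {p : ℝ} (hp : 0 ≤ p) :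
    ∫ t : ℝ, |t| ^ p * Real.exp (-t ^ 2) = Real.Gamma ((p + 1) / 2) := by
  have h := integral_comp_abs (f := fun t : ℝ => t ^ p * Real.exp (-t ^ (2 : ℝ)))
  rw [integral_rpow_mul_exp_neg_rpow two_pos (by linarith)] at h
  simpa using h

section Sphere

variable {n : ℕ}

lemma integral_inner_mul_exp_eq (p : ℝ) (v w : EuclideanSpace ℝ (Fin (n + 1))) (h : ‖v‖ = ‖w‖) :
    ∫ x : EuclideanSpace ℝ (Fin (n + 1)), |inner ℝ v x| ^ p * Real.exp (-‖x‖ ^ 2) =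
      ∫ x : EuclideanSpace ℝ (Fin (n + 1)), |inner ℝ w x| ^ p * Real.exp (-‖x‖ ^ 2) := by
  set R := (Submodule.span ℝ {v - w})ᗮ.reflection with hR
  have hv : R v = w := Submodule.reflection_sub h
  symm
  rw [← R.measurePreserving.integral_comp R.toHomeomorph.measurableEmbedding]
  refine integral_congr_ae (Filter.Eventually.of_forall fun x => ?_)
  beta_reduce
  rw [← hv, R.inner_map_map, R.norm_map]

lemma integral_inner_mul_exp {p : ℝ} (hp : 0 ≤ p) (v : EuclideanSpace ℝ (Fin (n + 1))) :
    ∫ x : EuclideanSpace ℝ (Fin (n + 1)), |inner ℝ v x| ^ p * Real.exp (-‖x‖ ^ 2) =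
      ‖v‖ ^ p * (Real.Gamma ((p + 1) / 2) * Real.sqrt Real.pi ^ n) := by
  rw [integral_inner_mul_exp_eq p v (EuclideanSpace.single 0 ‖v‖) (by simp),
    ← (PiLp.volume_preserving_toLp (Fin (n + 1))).integral_comp
      (MeasurableEquiv.toLp 2 (Fin (n + 1) → ℝ)).measurableEmbedding]
  have e (x : Fin (n + 1) → ℝ) :
      |inner ℝ (EuclideanSpace.single 0 ‖v‖) (WithLp.toLp 2 x)| ^ p *
        Real.exp (-‖WithLp.toLp 2 x‖ ^ 2) =
      ‖v‖ ^ p * ∏ i, (if i = 0 then |x i| ^ p else 1) * Real.exp (-x i ^ 2) := by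
    rw [EuclideanSpace.norm_sq_eq, ← Finset.sum_neg_distrib, Real.exp_sum, Finset.prod_mul_distrib,
      Finset.prod_ite_eq', if_pos (Finset.mem_univ _), ← mul_assoc]
    congr 1
    · rw [EuclideanSpace.inner_single_left]
      simp [abs_mul, Real.mul_rpow]
    · simp
  refine (integral_congr_ae (Filter.Eventually.of_forall e)).trans ?_
  rw [integral_const_mul, integral_fintype_prod_volume_eq_prod
    (f := fun (i : Fin (n + 1)) (t : ℝ) => (if i = 0 then |t| ^ p else 1) * Real.exp (-t ^ 2)),
    Fin.prod_univ_succ]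
  congr 2
  · simpa using integral_abs_rpow_mul_exp_neg_sq hp
  · have hg : ∫ t : ℝ, Real.exp (-t ^ 2) = Real.sqrt Real.pi := by
      simpa using integral_gaussian 1
    simp [hg]

lemma integral_sphere_inner_mul {p : ℝ} (hp : 0 ≤ p) (v : EuclideanSpace ℝ (Fin (n + 1))) :
    (∫ e : sphere (0 : EuclideanSpace ℝ (Fin (n + 1))) 1,
      |inner ℝ v (e : EuclideanSpace ℝ (Fin (n + 1)))| ^ p ∂volume.toSphere) *
        (Real.Gamma ((n + 1 + p) / 2) / 2) =
      ‖v‖ ^ p * (Real.Gamma ((p + 1) / 2) * Real.sqrt Real.pi ^ n) := by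
  rw [← integral_inner_mul_exp hp v]
  set μ := (volume : Measure (EuclideanSpace ℝ (Fin (n + 1)))) with hμ
  symm
  have hfin : Module.finrank ℝ (EuclideanSpace ℝ (Fin (n + 1))) - 1 = n := by simp
  calc
    ∫ x, |inner ℝ v x| ^ p * Real.exp (-‖x‖ ^ 2) ∂μ
      = ∫ x : ({(0)}ᶜ : Set (EuclideanSpace ℝ (Fin (n + 1)))),
          |inner ℝ v (x : EuclideanSpace ℝ (Fin (n + 1)))| ^ p * Real.exp (-‖x.1‖ ^ 2)
          ∂(μ.comap (↑)) := by
        rw [integral_subtype_comap (measurableSet_singleton _).compl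
          fun x => |inner ℝ v x| ^ p * Real.exp (-‖x‖ ^ 2), restrict_compl_singleton]
    _ = ∫ z, |inner ℝ v (z.1 : EuclideanSpace ℝ (Fin (n + 1)))| ^ p *
          ((z.2 : ℝ) ^ p * Real.exp (-(z.2 : ℝ) ^ 2)) ∂μ.toSphere.prod (.volumeIoiPow n) := by
        have := μ.measurePreserving_homeomorphUnitSphereProd.integral_comp
          (Homeomorph.measurableEmbedding _) (fun z =>
            |inner ℝ v (z.1 : EuclideanSpace ℝ (Fin (n + 1)))| ^ p *
              ((z.2 : ℝ) ^ p * Real.exp (-(z.2 : ℝ) ^ 2)))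
        rw [hfin] at this
        rw [← this]
        refine integral_congr_ae (Filter.Eventually.of_forall fun x => ?_)
        have hx : 0 < ‖x.1‖ := norm_pos_iff.2 x.2
        simp only [homeomorphUnitSphereProd_apply_fst_coe, homeomorphUnitSphereProd_apply_snd_coe]
        rw [inner_smul_right, abs_mul, abs_of_pos (inv_pos.2 hx),
          Real.mul_rpow (inv_pos.2 hx).le (abs_nonneg _), Real.inv_rpow hx.le]
        have : 0 < ‖x.1‖ ^ p := by positivity
        field_simp
    _ = _ := by
        refine (integral_prod_mul
          (fun e : sphere (0 : EuclideanSpace ℝ (Fin (n + 1))) 1 =>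
            |inner ℝ v (e : EuclideanSpace ℝ (Fin (n + 1)))| ^ p)
          (fun r : Ioi (0 : ℝ) => (r : ℝ) ^ p * Real.exp (-(r : ℝ) ^ 2))).trans ?_
        congr 1
        simp only [Measure.volumeIoiPow, ENNReal.ofReal]
        rw [integral_withDensity_eq_integral_smul
            (measurable_subtype_coe.pow_const _).real_toNNReal,
          integral_subtype_comap measurableSet_Ioi fun a : ℝ =>
            Real.toNNReal (a ^ n) • (a ^ p * Real.exp (-a ^ 2))]
        have h := integral_rpow_mul_exp_neg_rpow (p := 2) (q := n + p) two_pos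
          (by have : (0 : ℝ) ≤ n := n.cast_nonneg
              linarith)
        rw [show (n + 1 + p) / 2 = (n + p + 1) / 2 by ring, div_eq_inv_mul, ← one_div, ← h]
        refine setIntegral_congr_fun measurableSet_Ioi fun x hx => ?_
        have hx : 0 < x := hx
        simp only [NNReal.smul_def, Real.coe_toNNReal _ (pow_nonneg hx.le n), smul_eq_mul]
        rw [Real.rpow_add hx, Real.rpow_natCast, Real.rpow_two]
        ring

lemma average_sphere_inner {p : ℝ} (hp : 0 ≤ p) (v : EuclideanSpace ℝ (Fin (n + 1))) :
    Real.sqrt Real.pi * Real.Gamma ((n + 1 + p) / 2) /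
      (Real.Gamma ((p + 1) / 2) * Real.Gamma ((n + 1 : ℝ) / 2)) *
      ⨍ e : sphere (0 : EuclideanSpace ℝ (Fin (n + 1))) 1,
        |inner ℝ v (e : EuclideanSpace ℝ (Fin (n + 1)))| ^ p ∂volume.toSphere = ‖v‖ ^ p := by
  have hn : (0 : ℝ) ≤ n := n.cast_nonneg
  have h1 := integral_sphere_inner_mul hp v
  have h2 := integral_sphere_inner_mul le_rfl v
  have g1 : 0 < Real.Gamma ((n + 1 + p) / 2) := Real.Gamma_pos_of_pos (by positivity)
  have g2 : 0 < Real.Gamma ((p + 1) / 2) := Real.Gamma_pos_of_pos (by positivity)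
  have g3 : 0 < Real.Gamma ((n + 1 : ℝ) / 2) := Real.Gamma_pos_of_pos (by positivity)
  have g4 : 0 < Real.sqrt Real.pi := Real.sqrt_pos.2 Real.pi_pos
  simp only [Real.rpow_zero, integral_const, smul_eq_mul, mul_one, add_zero, zero_add, one_mul,
    Real.Gamma_one_half_eq] at h2
  rw [average_eq, smul_eq_mul]
  set S := ((volume : Measure (EuclideanSpace ℝ (Fin (n + 1)))).toSphere).real univ with hS
  have hS0 : S ≠ 0 := by
    intro h
    rw [h, zero_mul] at h2
    have : 0 < Real.sqrt Real.pi * Real.sqrt Real.pi ^ n := by positivity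
    exact this.ne h2
  set X := ∫ e : sphere (0 : EuclideanSpace ℝ (Fin (n + 1))) 1,
    |inner ℝ v (e : EuclideanSpace ℝ (Fin (n + 1)))| ^ p ∂volume.toSphere with hX
  rw [show Real.sqrt Real.pi * Real.Gamma ((n + 1 + p) / 2) /
      (Real.Gamma ((p + 1) / 2) * Real.Gamma ((n + 1 : ℝ) / 2)) * (S⁻¹ * X) =
    Real.sqrt Real.pi * (X * (Real.Gamma ((n + 1 + p) / 2) / 2)) /
      (Real.Gamma ((p + 1) / 2) * (S * (Real.Gamma ((n + 1 : ℝ) / 2) / 2))) by field_simp, h1, h2]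
  field_simp

end Sphere

lemma density_eq_average {n : ℕ} {p : ℝ} (hp : 2 ≤ p) {Ω : Set (EuclideanSpace ℝ (Fin (n + 1)))}
    {u : EuclideanSpace ℝ (Fin (n + 1)) → ℝ} (hΩ : IsOpen Ω)
    (huc : HasCompactSupport u) (hus : tsupport u ⊆ Ω) (x : EuclideanSpace ℝ (Fin (n + 1))) :
    ‖fderiv ℝ u x‖ ^ p - ((p - 1) / p) ^ p * |u x| ^ p / daviesWeightP p Ω x ^ p =
      Real.sqrt Real.pi * Real.Gamma ((n + 1 + p) / 2) /
        (Real.Gamma ((p + 1) / 2) * Real.Gamma ((n + 1 : ℝ) / 2)) *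
      ⨍ e : sphere (0 : EuclideanSpace ℝ (Fin (n + 1))) 1,
        dirDensity p ((p - 1) / p) Ω u x e ∂volume.toSphere := by
  have hp0 : 0 < p := by linarith
  set σ := (volume : Measure (EuclideanSpace ℝ (Fin (n + 1)))).toSphere with hσ
  set c := Real.sqrt Real.pi * Real.Gamma ((n + 1 + p) / 2) /
    (Real.Gamma ((p + 1) / 2) * Real.Gamma ((n + 1 : ℝ) / 2)) with hc
  have hc0 : 0 < c := by
    have g1 : 0 < Real.Gamma ((n + 1 + p) / 2) := Real.Gamma_pos_of_pos (by positivity)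
    have g2 : 0 < Real.Gamma ((p + 1) / 2) := Real.Gamma_pos_of_pos (by positivity)
    have g3 : 0 < Real.Gamma ((n + 1 : ℝ) / 2) := Real.Gamma_pos_of_pos (by positivity)
    have g4 : 0 < Real.sqrt Real.pi := Real.sqrt_pos.2 Real.pi_pos
    positivity
  by_cases hx : x ∈ tsupport u
  · set A := ⨍ e : sphere (0 : EuclideanSpace ℝ (Fin (n + 1))) 1,
      dirDist Ω x (e : EuclideanSpace ℝ (Fin (n + 1))) ^ (-p) ∂σ with hA
    have hA0 : 0 ≤ A := by
      rw [hA, average_eq, smul_eq_mul]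
      exact mul_nonneg (inv_nonneg.2 measureReal_nonneg)
        (integral_nonneg fun e => Real.rpow_nonneg (dirDist_nonneg _ _) _)
    have hD : daviesWeightP p Ω x = (c * A) ^ (-1 / p) := by
      rw [daviesWeightP, ← hσ, ← hA, hc]
      push_cast
      rfl
    have hD' : daviesWeightP p Ω x ^ p = (c * A)⁻¹ := by
      rw [hD, ← Real.rpow_mul (by positivity), div_mul_cancel₀ _ hp0.ne', Real.rpow_neg_one]
    set v := (InnerProductSpace.toDual ℝ (EuclideanSpace ℝ (Fin (n + 1)))).symm (fderiv ℝ u x) with hv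
    have hvn : ‖fderiv ℝ u x‖ = ‖v‖ := (LinearIsometryEquiv.norm_map _ _).symm
    have hve (e) : fderiv ℝ u x e = inner ℝ v e := (InnerProductSpace.toDual_symm_apply).symm
    have hi1 : Integrable (fun e : sphere (0 : EuclideanSpace ℝ (Fin (n + 1))) 1 =>
        |fderiv ℝ u x e| ^ p) σ :=
      Continuous.integrable_of_hasCompactSupport
        (((fderiv ℝ u x).continuous.comp continuous_subtype_val).abs.rpow_const
          fun _ => Or.inr hp0.le) (HasCompactSupport.of_compactSpace _)
    have hi2 : Integrable (fun e : sphere (0 : EuclideanSpace ℝ (Fin (n + 1))) 1 =>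
        dirDist Ω x (e : EuclideanSpace ℝ (Fin (n + 1))) ^ (-p)) σ := by
      obtain ⟨δ, hδ, h⟩ := exists_pos_le_dist_compl hΩ huc hus
      refine Integrable.of_bound (C := δ ^ (-p)) ?_ (Filter.Eventually.of_forall fun e => ?_)
      · exact ((measurable_dirDist hΩ).comp
          (measurable_const.prodMk measurable_subtype_coe)).pow_const (-p) |>.aestronglyMeasurable
      · rw [Real.norm_eq_abs, abs_of_nonneg (Real.rpow_nonneg (dirDist_nonneg _ _) _)]
        exact dirDist_rpow_neg_le hp0 hδ (by simp) (h x hx)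
    have hav : ⨍ e : sphere (0 : EuclideanSpace ℝ (Fin (n + 1))) 1,
        dirDensity p ((p - 1) / p) Ω u x e ∂σ =
        (⨍ e : sphere (0 : EuclideanSpace ℝ (Fin (n + 1))) 1,
          |inner ℝ v (e : EuclideanSpace ℝ (Fin (n + 1)))| ^ p ∂σ) -
          ((p - 1) / p) ^ p * (|u x| ^ p * A) := by
      simp only [hA, average_eq, smul_eq_mul, dirDensity, ← hve]
      rw [integral_sub hi1 ((hi2.const_mul _).const_mul _), integral_const_mul, integral_const_mul]
      ring
    rw [hav, mul_sub, average_sphere_inner hp0.le v, hD', div_inv_eq_mul, hvn]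
    ring
  · simp [dirDensity_eq_zero hp0 hx, fderiv_of_notMem_tsupport (𝕜 := ℝ) hx,
      image_eq_zero_of_notMem_tsupport hx, Real.zero_rpow hp0.ne']

/-- **`L^p` Hardy–Sobolev–Maz'ya inequality** (Theorem 3): for `2 ≤ p < N` there is `K_{N,p} > 0`
such that for every domain `Ω ⊊ ℝ^N` and every `u ∈ C_0^∞(Ω)`,
`∫_Ω (|∇u|^p − ((p−1)/p)^p |u|^p / D_{Ω,p}^p) dx ≥ K_{N,p} (∫_Ω |u|^{Np/(N−p)} dx)^{(N−p)/N}`. -/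
theorem hardy_sobolev_mazya_p (N : ℕ) (p : ℝ) (hp : 2 ≤ p) (hpN : p < N) :
    ∃ K : ℝ, 0 < K ∧
      ∀ (Ω : Set (EuclideanSpace ℝ (Fin N))), IsOpen Ω → IsConnected Ω → Ω ≠ Set.univ →
        ∀ u : EuclideanSpace ℝ (Fin N) → ℝ,
          ContDiff ℝ (⊤ : ℕ∞) u → HasCompactSupport u → tsupport u ⊆ Ω →
          K * (∫ x in Ω, |u x| ^ ((N : ℝ) * p / ((N : ℝ) - p))) ^ (((N : ℝ) - p) / (N : ℝ)) ≤
            ∫ x in Ω, (‖fderiv ℝ u x‖ ^ p -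
              ((p - 1) / p) ^ p * |u x| ^ p / daviesWeightP p Ω x ^ p) := by
  obtain ⟨n, rfl⟩ : ∃ n, N = n + 1 := Nat.exists_eq_succ_of_ne_zero <| by
    rintro rfl
    norm_num at hpN
    linarith
  push_cast at hpN ⊢
  have hp0 : 0 < p := by linarith
  have hn : 1 ≤ n := by
    have : (1 : ℝ) < n := by linarith
    exact_mod_cast this.le
  have hα : (p - 1) / p * p = p - 1 := div_mul_cancel₀ _ hp0.ne'
  have hα0 : 0 ≤ (p - 1) / p := div_nonneg (by linarith) hp0.le
  obtain ⟨K, hK, h⟩ := exists_gns_sphere hn hp hpN hα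
  set σ := (volume : Measure (EuclideanSpace ℝ (Fin (n + 1)))).toSphere with hσ
  set c := Real.sqrt Real.pi * Real.Gamma ((n + 1 + p) / 2) /
    (Real.Gamma ((p + 1) / 2) * Real.Gamma ((n + 1 : ℝ) / 2)) with hc
  have hc0 : 0 < c := by
    have g1 : 0 < Real.Gamma ((n + 1 + p) / 2) := Real.Gamma_pos_of_pos (by positivity)
    have g2 : 0 < Real.Gamma ((p + 1) / 2) := Real.Gamma_pos_of_pos (by positivity)
    have g3 : 0 < Real.Gamma ((n + 1 : ℝ) / 2) := Real.Gamma_pos_of_pos (by positivity)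
    have g4 : 0 < Real.sqrt Real.pi := Real.sqrt_pos.2 Real.pi_pos
    positivity
  have hσ0 : 0 < σ.real univ :=
    ENNReal.toReal_pos (Measure.measure_univ_ne_zero.2 (Measure.toSphere_ne_zero _))
      (measure_ne_top _ _)
  refine ⟨c * (σ.real univ)⁻¹ * K, by positivity, fun Ω hΩ _ _ u hu huc hus => ?_⟩
  have hu1 : ContDiff ℝ 1 u := hu.of_le (by exact_mod_cast le_top)
  have hr : (n + 1 : ℝ) * p / (n + 1 - p) ≠ 0 :=
    (div_pos (by positivity) (by linarith)).ne'
  have hout {x} (hx : x ∉ Ω) : x ∉ tsupport u := fun h' => hx (hus h')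
  rw [setIntegral_eq_integral_of_forall_compl_eq_zero (μ := volume)
      (f := fun x => |u x| ^ ((n + 1 : ℝ) * p / (n + 1 - p)))
      (fun x hx => by simp [image_eq_zero_of_notMem_tsupport (hout hx), Real.zero_rpow hr]),
    setIntegral_eq_integral_of_forall_compl_eq_zero (μ := volume)
      (f := fun x => ‖fderiv ℝ u x‖ ^ p -
        ((p - 1) / p) ^ p * |u x| ^ p / daviesWeightP p Ω x ^ p)
      (fun x hx => by simp [fderiv_of_notMem_tsupport (𝕜 := ℝ) (hout hx),
        image_eq_zero_of_notMem_tsupport (hout hx), Real.zero_rpow hp0.ne'])]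
  have hswap := integral_integral_swap (μ := volume) (ν := σ)
    (f := fun x e => dirDensity p ((p - 1) / p) Ω u x e) (integrable_dirDensity_prod (α := (p - 1) / p) hp0 hα0 hΩ hu1
    huc hus σ)
  simp only [density_eq_average hp hΩ huc hus, average_eq, smul_eq_mul, ← hσ, ← hc]
  rw [integral_const_mul, integral_const_mul, hswap, mul_assoc, mul_assoc]
  exact mul_le_mul_of_nonneg_left (mul_le_mul_of_nonneg_left (h Ω u hΩ hu1 huc hus)
    (inv_pos.2 hσ0).le) hc0.le
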